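/- arXiv:2512.02151 — 10 statements merged into one kernel-verified Lean document; each statement's English description precedes it below -/
import Mathlib

section
/- Let f : [0,1] → [0,1] be increasing (monotone non-decreasing). Set a = I(f)(1), b = I²(f)(1), c = I³(f)(1). Then the following inequalities hold: (a) 0 ≤ a ≤ 1; (b) a²/2 ≤ b ≤ a/2; (c) 2b² ≤ 3ac; (d) 6(1−a)c ≤ −a² + 2ab − 4b² + 2b; (e) 0 ≤ c ≤ a/6. -/
open Set

/-- The integral operator `I(f)(x) = ∫₀ˣ f(t) dt`. -/
noncomputable def I (f : ℝ → ℝ) : ℝ → ℝ := fun x => ∫ t in (0:ℝ)..x, f t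

open MeasureTheory intervalIntegral

/-- Integration by parts against the primitive of an integrable function. -/
lemma integral_primitive_mul {f v v' : ℝ → ℝ} (hf : IntervalIntegrable f volume 0 1)
    (hv : ContDiff ℝ 1 v) (hv' : ∀ x, HasDerivAt v (v' x) x) (hv1 : v 1 = 0) :
    ∫ x in (0:ℝ)..1, I f x * v' x = -∫ x in (0:ℝ)..1, f x * v x := by
  have hac : AbsolutelyContinuousOnInterval (I f) 0 1 :=
    hf.absolutelyContinuousOnInterval_intervalIntegral (c := 0) (by simp)
  have key := hac.integral_mul_deriv_eq_deriv_mul hv.contDiffOn.absolutelyContinuousOnInterval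
  have h0 : I f 0 = 0 := by simp [I]
  rw [h0, hv1, show deriv v = v' from funext fun x => (hv' x).deriv] at key
  rw [key]
  have hcongr : ∫ x in (0:ℝ)..1, deriv (I f) x * v x = ∫ x in (0:ℝ)..1, f x * v x := by
    apply intervalIntegral.integral_congr_ae
    filter_upwards [hf.ae_hasDerivAt_integral] with x hx hxm
    rw [show deriv (I f) x = f x from (hx (uIoc_subset_uIcc hxm) 0 (by simp)).deriv]
  rw [hcongr]
  ring

lemma I_I_one {f : ℝ → ℝ} (hf : IntervalIntegrable f volume 0 1) :
    I (I f) 1 = ∫ x in (0:ℝ)..1, f x * (1 - x) := by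
  have h := integral_primitive_mul (v := fun x => x - 1) (v' := fun _ => 1) hf (by fun_prop)
    (fun x => (hasDerivAt_id x).sub_const 1) (by simp)
  rw [← intervalIntegral.integral_neg] at h
  simpa [I, ← mul_neg] using h

lemma I_I_I_one {f : ℝ → ℝ} (hf : IntervalIntegrable f volume 0 1) :
    2 * I (I (I f)) 1 = ∫ x in (0:ℝ)..1, f x * (1 - x) ^ 2 := by
  have hac : AbsolutelyContinuousOnInterval (I f) 0 1 :=
    hf.absolutelyContinuousOnInterval_intervalIntegral (c := 0) (by simp)
  have h := integral_primitive_mul (v := fun x => -(1 - x) ^ 2) (v' := fun x => 2 * (1 - x)) hf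
    (by fun_prop)
    (fun x => (((hasDerivAt_id x).const_sub 1).pow 2).neg.congr_deriv (by norm_num)) (by simp)
  rw [I_I_one hac.continuousOn.intervalIntegrable, ← intervalIntegral.integral_const_mul]
  rw [← intervalIntegral.integral_neg] at h
  simp only [mul_neg, neg_neg] at h
  rw [← h]
  exact integral_congr fun x _ => by ring

lemma integral_quadratic (α β γ p r : ℝ) :
    ∫ t in p..r, (α + β * (1 - t) + γ * (1 - t) ^ 2) =
      (α * (1 - p) + β * (1 - p) ^ 2 / 2 + γ * (1 - p) ^ 3 / 3) -
        (α * (1 - r) + β * (1 - r) ^ 2 / 2 + γ * (1 - r) ^ 3 / 3) := by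
  have hd : ∀ t ∈ uIcc p r, HasDerivAt
      (fun t : ℝ => -(α * (1 - t) + β * (1 - t) ^ 2 / 2 + γ * (1 - t) ^ 3 / 3))
      (α + β * (1 - t) + γ * (1 - t) ^ 2) t := by
    intro t _
    have h1 : HasDerivAt (fun t : ℝ => 1 - t) (-1) t := (hasDerivAt_id t).const_sub 1
    refine (((h1.const_mul α).add (((h1.pow 2).const_mul β).div_const 2)).add
      (((h1.pow 3).const_mul γ).div_const 3)).neg.congr_deriv ?_
    norm_num
    ring
  rw [integral_eq_sub_of_hasDerivAt hd (by apply Continuous.intervalIntegrable; fun_prop)]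
  ring

/-- A weight changing sign from negative to positive at `t₀` integrates an increasing function
to at least its value at `t₀` times the total weight. -/
lemma mul_integral_le_integral_mul_of_monotoneOn {f q : ℝ → ℝ} {p r t₀ : ℝ}
    (hf : MonotoneOn f (Icc p r)) (hq : Continuous q) (ht₀ : t₀ ∈ Icc p r)
    (hsign : ∀ t ∈ Icc p r, 0 ≤ q t * (t - t₀)) :
    f t₀ * ∫ t in p..r, q t ≤ ∫ t in p..r, f t * q t := by
  have hpr : p ≤ r := ht₀.1.trans ht₀.2
  rw [← intervalIntegral.integral_const_mul]
  apply intervalIntegral.integral_mono_on hpr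
  · exact (hq.const_mul _).intervalIntegrable _ _
  · exact (MonotoneOn.intervalIntegrable (by rwa [uIcc_of_le hpr])).mul_continuousOn
      hq.continuousOn
  · intro t ht
    rcases lt_trichotomy t t₀ with h | rfl | h
    · have h1 := hf ht ht₀ h.le
      have h2 : q t ≤ 0 := by
        by_contra! h3
        nlinarith [hsign t ht, mul_pos h3 (sub_pos.2 h)]
      nlinarith
    · rfl
    · have h1 := hf ht₀ ht h.le
      have h2 : 0 ≤ q t := nonneg_of_mul_nonneg_left (hsign t ht) (sub_pos.2 h)
      nlinarith

section Moments

variable {f : ℝ → ℝ}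

lemma integral_mul_quadratic (hf : IntervalIntegrable f volume 0 1) (α β γ : ℝ) :
    ∫ t in (0:ℝ)..1, f t * (α + β * (1 - t) + γ * (1 - t) ^ 2) =
      α * I f 1 + β * I (I f) 1 + γ * (2 * I (I (I f)) 1) := by
  rw [I_I_one hf, I_I_I_one hf, I, ← intervalIntegral.integral_const_mul,
    ← intervalIntegral.integral_const_mul, ← intervalIntegral.integral_const_mul,
    ← intervalIntegral.integral_add, ← intervalIntegral.integral_add]
  · exact integral_congr fun x _ => by ring
  · exact (hf.const_mul _).add ((hf.mul_continuousOn (by fun_prop)).const_mul _)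
  · exact (hf.mul_continuousOn (by fun_prop)).const_mul _
  · exact hf.const_mul _
  · exact (hf.mul_continuousOn (by fun_prop)).const_mul _

lemma integral_mul_quadratic_split (hf : IntervalIntegrable f volume 0 1) (α β γ : ℝ) {l : ℝ}
    (hl : l ∈ Icc (0:ℝ) 1) :
    α * I f 1 + β * I (I f) 1 + γ * (2 * I (I (I f)) 1) =
      (∫ t in (0:ℝ)..(1 - l), f t * (α + β * (1 - t) + γ * (1 - t) ^ 2)) +
        ∫ t in (1 - l)..1, f t * (α + β * (1 - t) + γ * (1 - t) ^ 2) := by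
  have hm : 1 - l ∈ uIcc (0:ℝ) 1 := by
    rw [uIcc_of_le zero_le_one]; constructor <;> linarith [hl.1, hl.2]
  have hg : IntervalIntegrable (fun t => f t * (α + β * (1 - t) + γ * (1 - t) ^ 2)) volume 0 1 :=
    hf.mul_continuousOn (by fun_prop)
  rw [← integral_mul_quadratic hf, integral_add_adjacent_intervals]
  · exact hg.mono_set (uIcc_subset_uIcc left_mem_uIcc hm)
  · exact hg.mono_set (uIcc_subset_uIcc hm right_mem_uIcc)

lemma integral_mul_nonneg_of_nonneg {q : ℝ → ℝ} {p r : ℝ} (hpr : p ≤ r)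
    (hf : ∀ t ∈ Icc p r, 0 ≤ f t) (hq : ∀ t ∈ Icc p r, 0 ≤ q t) :
    0 ≤ ∫ t in p..r, f t * q t :=
  intervalIntegral.integral_nonneg hpr fun t ht => mul_nonneg (hf t ht) (hq t ht)

lemma integral_le_integral_mul_of_nonpos {q : ℝ → ℝ} {p r : ℝ} (hpr : p ≤ r)
    (hfi : IntervalIntegrable f volume p r) (hqc : Continuous q)
    (hf : ∀ t ∈ Icc p r, f t ≤ 1) (hq : ∀ t ∈ Icc p r, q t ≤ 0) :
    ∫ t in p..r, q t ≤ ∫ t in p..r, f t * q t :=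
  intervalIntegral.integral_mono_on hpr (hqc.intervalIntegrable _ _)
    (hfi.mul_continuousOn hqc.continuousOn) fun t ht => by nlinarith [hf t ht, hq t ht]

lemma MonotoneOn.intervalIntegrable_of_Icc {p r : ℝ} (hpr : p ≤ r)
    (hmono : MonotoneOn f (Icc p r)) : IntervalIntegrable f volume p r :=
  MonotoneOn.intervalIntegrable (by rwa [uIcc_of_le hpr])

/-- A weighted second-moment inequality: the weight is the derivative of `s * (s - l) ^ 2`
at `s = 1 - t`. -/
lemma quadratic_form_nonneg
    (hmono : MonotoneOn f (Icc 0 1)) (hmap : ∀ x ∈ Icc (0:ℝ) 1, f x ∈ Icc (0:ℝ) 1)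
    {l : ℝ} (hl : l ∈ Icc (0:ℝ) 1) :
    0 ≤ l ^ 2 * I f 1 + (-4 * l) * I (I f) 1 + 3 * (2 * I (I (I f)) 1) := by
  obtain ⟨hl0, hl1⟩ := hl
  rw [integral_mul_quadratic_split (hmono.intervalIntegrable_of_Icc zero_le_one) _ _ _ ⟨hl0, hl1⟩]
  refine add_nonneg (integral_mul_nonneg_of_nonneg (by linarith) ?_ ?_) ?_
  · exact fun t ht => (hmap t ⟨ht.1, by linarith [ht.2]⟩).1
  · intro t ht
    have h1 : 0 ≤ 1 - t - l := by linarith [ht.2]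
    nlinarith [mul_nonneg h1 (by linarith : 0 ≤ 3 * (1 - t) - l)]
  · have h := mul_integral_le_integral_mul_of_monotoneOn (p := 1 - l) (r := 1) (t₀ := 1 - l / 3)
      (q := fun t => l ^ 2 + (-4 * l) * (1 - t) + 3 * (1 - t) ^ 2)
      (hmono.mono (Icc_subset_Icc (by linarith) le_rfl)) (by fun_prop)
      ⟨by linarith, by linarith⟩ ?_
    · rw [integral_quadratic] at h
      refine le_of_eq_of_le ?_ h
      ring
    · intro t ht
      have h1 : 0 ≤ l - (1 - t) := by linarith [ht.1]
      have h2 := mul_nonneg h1 (sq_nonneg (3 * (1 - t) - l))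
      nlinarith [h2]

/-- A weighted second-moment inequality: the weight is the derivative of `(1 - s) * (s - l) ^ 2`
at `s = 1 - t`. -/
lemma dual_quadratic_form_nonneg
    (hmono : MonotoneOn f (Icc 0 1)) (hmap : ∀ x ∈ Icc (0:ℝ) 1, f x ∈ Icc (0:ℝ) 1)
    {l : ℝ} (hl : l ∈ Icc (0:ℝ) 1) :
    0 ≤ l ^ 2 + (-(l ^ 2 + 2 * l) * I f 1 + (2 + 4 * l) * I (I f) 1 +
      (-3) * (2 * I (I (I f)) 1)) := by
  obtain ⟨hl0, hl1⟩ := hl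
  rw [integral_mul_quadratic_split (hmono.intervalIntegrable_of_Icc zero_le_one) _ _ _ ⟨hl0, hl1⟩]
  have h1 := mul_integral_le_integral_mul_of_monotoneOn (p := 0) (r := 1 - l) (t₀ := (1 - l) / 3)
    (q := fun t => -(l ^ 2 + 2 * l) + (2 + 4 * l) * (1 - t) + (-3) * (1 - t) ^ 2)
    (hmono.mono (Icc_subset_Icc le_rfl (by linarith))) (by fun_prop)
    ⟨by linarith, by linarith⟩ (fun t ht => by
      have h1 : 0 ≤ 1 - t - l := by linarith [ht.2]
      have h2 := mul_nonneg h1 (sq_nonneg (3 * t - (1 - l)))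
      nlinarith [h2])
  have h2 := integral_le_integral_mul_of_nonpos (f := f) (p := 1 - l) (r := 1)
    (q := fun t => -(l ^ 2 + 2 * l) + (2 + 4 * l) * (1 - t) + (-3) * (1 - t) ^ 2)
    (by linarith)
    ((hmono.mono (Icc_subset_Icc (by linarith) le_rfl)).intervalIntegrable_of_Icc (by linarith))
    (by fun_prop) (fun t ht => (hmap t ⟨by linarith [ht.1], ht.2⟩).2) (fun t ht => by
      have h1 : 0 ≤ l - (1 - t) := by linarith [ht.1]
      nlinarith [mul_nonneg h1 (by linarith [ht.1, ht.2] : 0 ≤ 2 - 3 * (1 - t) + l)])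
  rw [integral_quadratic] at h1 h2
  ring_nf at h1 h2 ⊢
  linarith

lemma I_one_mem
    (hmono : MonotoneOn f (Icc 0 1)) (hmap : ∀ x ∈ Icc (0:ℝ) 1, f x ∈ Icc (0:ℝ) 1) :
    I f 1 ∈ Icc (0:ℝ) 1 := by
  have hf := hmono.intervalIntegrable_of_Icc zero_le_one
  refine ⟨intervalIntegral.integral_nonneg zero_le_one fun t ht => (hmap t ht).1, ?_⟩
  have := intervalIntegral.integral_mono_on (g := fun _ => (1:ℝ)) zero_le_one hf (by simp)
    fun t ht => (hmap t ht).2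
  simpa [I] using this

lemma sq_I_one_le
    (hmono : MonotoneOn f (Icc 0 1)) (hmap : ∀ x ∈ Icc (0:ℝ) 1, f x ∈ Icc (0:ℝ) 1) :
    I f 1 ^ 2 ≤ 2 * I (I f) 1 := by
  obtain ⟨h0, h1⟩ := I_one_mem hmono hmap
  set l := I f 1 with hl
  have h := integral_mul_quadratic_split (hmono.intervalIntegrable_of_Icc zero_le_one)
    (-2 * l) 2 0 ⟨h0, h1⟩
  have hl_nonneg := integral_mul_nonneg_of_nonneg (f := f) (p := 0) (r := 1 - l)
    (q := fun t => -2 * l + 2 * (1 - t) + 0 * (1 - t) ^ 2) (by linarith)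
    (fun t ht => (hmap t ⟨ht.1, by linarith [ht.2]⟩).1) (fun t ht => by nlinarith [ht.2])
  have h2 := integral_le_integral_mul_of_nonpos (f := f) (p := 1 - l) (r := 1)
    (q := fun t => -2 * l + 2 * (1 - t) + 0 * (1 - t) ^ 2)
    (by linarith)
    ((hmono.mono (Icc_subset_Icc (by linarith) le_rfl)).intervalIntegrable_of_Icc (by linarith))
    (by fun_prop) (fun t ht => (hmap t ⟨by linarith [ht.1], ht.2⟩).2)
    (fun t ht => by nlinarith [ht.1])
  rw [integral_quadratic] at h2
  rw [← hl] at h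
  nlinarith

lemma two_mul_I_I_one_le (hmono : MonotoneOn f (Icc 0 1)) : 2 * I (I f) 1 ≤ I f 1 := by
  have h := mul_integral_le_integral_mul_of_monotoneOn (t₀ := 1 / 2)
    (q := fun t => 1 + (-2) * (1 - t) + 0 * (1 - t) ^ 2) hmono (by fun_prop)
    ⟨by norm_num, by norm_num⟩ (fun t _ => by nlinarith [sq_nonneg (t - 1 / 2)])
  rw [integral_quadratic,
    integral_mul_quadratic (hmono.intervalIntegrable_of_Icc zero_le_one)] at h
  linarith

lemma three_mul_I_I_I_one_le (hmono : MonotoneOn f (Icc 0 1)) :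
    3 * I (I (I f)) 1 ≤ I (I f) 1 := by
  have h := mul_integral_le_integral_mul_of_monotoneOn (t₀ := 1 / 3)
    (q := fun t => 0 + 2 * (1 - t) + (-3) * (1 - t) ^ 2) hmono (by fun_prop)
    ⟨by norm_num, by norm_num⟩ (fun t ht => by
      nlinarith [mul_nonneg (sub_nonneg.2 ht.2) (sq_nonneg (t - 1 / 3))])
  rw [integral_quadratic,
    integral_mul_quadratic (hmono.intervalIntegrable_of_Icc zero_le_one)] at h
  linarith

lemma I_I_I_one_nonneg
    (hmono : MonotoneOn f (Icc 0 1)) (hmap : ∀ x ∈ Icc (0:ℝ) 1, f x ∈ Icc (0:ℝ) 1) :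
    0 ≤ I (I (I f)) 1 := by
  have h := I_I_I_one (hmono.intervalIntegrable_of_Icc zero_le_one)
  have := integral_mul_nonneg_of_nonneg (q := fun t => (1 - t) ^ 2) zero_le_one
    (fun t ht => (hmap t ht).1) (fun t _ => sq_nonneg _)
  linarith

end Moments

theorem stmt0 (f : ℝ → ℝ)
    (hmono : MonotoneOn f (Icc 0 1))
    (hmap : ∀ x ∈ Icc (0:ℝ) 1, f x ∈ Icc (0:ℝ) 1)
    (a b c : ℝ)
    (ha : a = I f 1) (hb : b = I (I f) 1) (hc : c = I (I (I f)) 1) :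
    (0 ≤ a ∧ a ≤ 1) ∧
    (a ^ 2 / 2 ≤ b ∧ b ≤ a / 2) ∧
    2 * b ^ 2 ≤ 3 * a * c ∧
    6 * (1 - a) * c ≤ -a ^ 2 + 2 * a * b - 4 * b ^ 2 + 2 * b ∧
    (0 ≤ c ∧ c ≤ a / 6) := by
  subst ha hb hc
  have hA := I_one_mem hmono hmap
  have hB := sq_I_one_le hmono hmap
  have hB' := two_mul_I_I_one_le hmono
  have hC := I_I_I_one_nonneg hmono hmap
  have hC' := three_mul_I_I_I_one_le hmono
  have hQ := fun l hl => quadratic_form_nonneg hmono hmap (l := l) hl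
  have hD := fun l hl => dual_quadratic_form_nonneg hmono hmap (l := l) hl
  generalize I (I (I f)) 1 = c at *
  generalize I (I f) 1 = b at *
  generalize I f 1 = a at *
  obtain ⟨h0, h1⟩ := hA
  have hb0 : 0 ≤ b := by nlinarith
  refine ⟨⟨h0, h1⟩, ⟨by linarith, by linarith⟩, ?_, ?_, hC, by linarith⟩
  · rcases h0.eq_or_lt with rfl | ha
    · have : b = 0 := by linarith
      simp [this]
    · have h := hQ (2 * b / a) ⟨by positivity, by rw [div_le_one ha]; linarith⟩
      have h2 := mul_nonneg ha.le h
      field_simp at h2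
      nlinarith
  · rcases h1.eq_or_lt with rfl | ha
    · have : b = 1 / 2 := by linarith
      subst this
      norm_num
    · have ha' : 0 < 1 - a := by linarith
      obtain ⟨l, hl⟩ : ∃ l, l * (1 - a) = a - 2 * b :=
        ⟨(a - 2 * b) / (1 - a), by field_simp⟩
      have h := hD l ⟨by by_contra! hn; nlinarith, by by_contra! hn; nlinarith⟩
      have h2 := mul_nonneg ha'.le h
      have e : (1 - a) * (l ^ 2 + (-(l ^ 2 + 2 * l) * a + (2 + 4 * l) * b + (-3) * (2 * c))) =
          (l * (1 - a)) ^ 2 - 2 * (l * (1 - a)) * (a - 2 * b) + (1 - a) * (2 * b - 6 * c) := by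
        ring
      rw [e, hl] at h2
      nlinarith
end

section
/- Let a, b, c be real numbers satisfying: 0 ≤ a ≤ 1; a²/2 ≤ b ≤ a/2; 2b² ≤ 3ac; 6(1−a)c ≤ −a² + 2ab − 4b² + 2b; and 0 ≤ c ≤ a/6. Then there exists an increasing function f : [0,1] → [0,1] such that I(f)(1) = a, I²(f)(1) = b, and I³(f)(1) = c. -/
open Set

/-- The truncated power `(t - s)₊ ^ n`, equal to the indicator of `[s, ∞)` for `n = 0`. -/
noncomputable def truncPow (s : ℝ) (n : ℕ) (t : ℝ) : ℝ := if s ≤ t then (t - s) ^ n else 0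

theorem truncPow_monotone (s : ℝ) (n : ℕ) : Monotone (truncPow s n) := by
  intro x y hxy
  unfold truncPow
  split_ifs with hx hy hy
  · have := sub_nonneg.2 hx
    gcongr
  · linarith
  · have := sub_nonneg.2 hy
    positivity
  · exact le_rfl

theorem truncPow_intervalIntegrable (s : ℝ) (n : ℕ) (x y : ℝ) :
    IntervalIntegrable (truncPow s n) MeasureTheory.volume x y :=
  (truncPow_monotone s n).intervalIntegrable

theorem integral_truncPow_of_le {s x : ℝ} (n : ℕ) (hx : 0 ≤ x) (hxs : x ≤ s) :
    ∫ t in (0:ℝ)..x, truncPow s n t = 0 := by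
  have h : ∫ t in (0:ℝ)..x, truncPow s n t = ∫ _ in (0:ℝ)..x, (0:ℝ) := by
    apply intervalIntegral.integral_congr_ae
    filter_upwards [MeasureTheory.Measure.ae_ne MeasureTheory.volume s] with t ht hmem
    rw [uIoc_of_le hx] at hmem
    exact if_neg fun h => ht (le_antisymm (hmem.2.trans hxs) h)
  simpa using h

theorem integral_truncPow {s x : ℝ} (n : ℕ) (hs : 0 ≤ s) (hx : 0 ≤ x) :
    ∫ t in (0:ℝ)..x, truncPow s n t = truncPow s (n + 1) x / (n + 1) := by
  by_cases hsx : s ≤ x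
  · rw [← intervalIntegral.integral_add_adjacent_intervals
      (truncPow_intervalIntegrable s n 0 s) (truncPow_intervalIntegrable s n s x),
      integral_truncPow_of_le n hs le_rfl, zero_add]
    have h : ∫ t in s..x, truncPow s n t = ∫ t in s..x, (t - s) ^ n := by
      apply intervalIntegral.integral_congr
      intro t ht
      rw [uIcc_of_le hsx] at ht
      exact if_pos ht.1
    rw [h, intervalIntegral.integral_comp_sub_right (fun t => t ^ n), integral_pow]
    simp [truncPow, hsx]
  · rw [integral_truncPow_of_le n hx (not_le.1 hsx).le]
    simp [truncPow, hsx]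

theorem I_congr {f g : ℝ → ℝ} (h : ∀ x, 0 ≤ x → f x = g x) {x : ℝ} (hx : 0 ≤ x) :
    I f x = I g x := by
  apply intervalIntegral.integral_congr
  intro t ht
  rw [uIcc_of_le hx] at ht
  exact h t ht.1

theorem I_pow_add_truncPow {s x : ℝ} (p w : ℝ) (n : ℕ) (hs : 0 ≤ s) (hx : 0 ≤ x) :
    I (fun t => p * t ^ n + w * truncPow s n t) x =
      p / (n + 1) * x ^ (n + 1) + w / (n + 1) * truncPow s (n + 1) x := by
  unfold I
  rw [intervalIntegral.integral_add, intervalIntegral.integral_const_mul,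
    intervalIntegral.integral_const_mul, integral_truncPow n hs hx, integral_pow]
  · simp
    ring
  · exact (by fun_prop : Continuous fun t : ℝ => p * t ^ n).intervalIntegrable _ _
  · exact (truncPow_intervalIntegrable s n 0 x).const_mul w

/-- A step function with values `p` and `p + w` jumping at `1 - t` realizes the iterated integrals
of the measure `p δ₁ + w δₜ`. -/
theorem exists_monotoneOn_of_moments {a b c p w t : ℝ} (hp : 0 ≤ p) (hw : 0 ≤ w)
    (hpw : p + w ≤ 1) (ht0 : 0 ≤ t) (ht1 : t ≤ 1) (ha : p + w * t = a)
    (hb : p + w * t ^ 2 = 2 * b) (hc : p + w * t ^ 3 = 6 * c) :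
    ∃ f : ℝ → ℝ, MonotoneOn f (Icc 0 1) ∧
      (∀ x ∈ Icc (0:ℝ) 1, f x ∈ Icc (0:ℝ) 1) ∧
      I f 1 = a ∧ I (I f) 1 = b ∧ I (I (I f)) 1 = c := by
  have hs : 0 ≤ 1 - t := by linarith
  have e1 := fun x hx => I_pow_add_truncPow (x := x) p w 0 hs hx
  have e2 : ∀ x, 0 ≤ x → I (I fun y => p * y ^ 0 + w * truncPow (1 - t) 0 y) x = _ :=
    fun x hx => (I_congr e1 hx).trans (I_pow_add_truncPow _ _ 1 hs hx)
  have e3 : ∀ x, 0 ≤ x → I (I (I fun y => p * y ^ 0 + w * truncPow (1 - t) 0 y)) x = _ :=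
    fun x hx => (I_congr e2 hx).trans (I_pow_add_truncPow _ _ 2 hs hx)
  have hval : ∀ n, truncPow (1 - t) n 1 = t ^ n := fun n => by simp [truncPow, ht0]
  refine ⟨fun y => p * y ^ 0 + w * truncPow (1 - t) 0 y, ?_, ?_, ?_, ?_, ?_⟩
  · intro x _ y _ hxy
    have := mul_le_mul_of_nonneg_left (truncPow_monotone (1 - t) 0 hxy) hw
    simpa using this
  · intro x _
    simp only [truncPow, pow_zero, mem_Icc]
    split_ifs <;> constructor <;> linarith
  · rw [e1 1 zero_le_one, hval]
    norm_num
    linarith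
  · rw [e2 1 zero_le_one, hval]
    norm_num
    linarith
  · rw [e3 1 zero_le_one, hval]
    norm_num
    linarith

theorem stmt1 (a b c : ℝ)
    (h1 : 0 ≤ a) (h2 : a ≤ 1)
    (h3 : a ^ 2 / 2 ≤ b) (h4 : b ≤ a / 2)
    (h5 : 2 * b ^ 2 ≤ 3 * a * c)
    (h6 : 6 * (1 - a) * c ≤ -a ^ 2 + 2 * a * b - 4 * b ^ 2 + 2 * b)
    (h7 : 0 ≤ c) (h8 : c ≤ a / 6) :
    ∃ f : ℝ → ℝ, MonotoneOn f (Icc 0 1) ∧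
      (∀ x ∈ Icc (0:ℝ) 1, f x ∈ Icc (0:ℝ) 1) ∧
      I f 1 = a ∧ I (I f) 1 = b ∧ I (I (I f)) 1 = c := by
  rcases h4.eq_or_lt with hb | hb
  · have hc : 6 * c = a := by
      rcases h1.eq_or_lt with ha | ha
      · linarith
      · subst hb
        have : a ≤ 6 * c := le_of_mul_le_mul_left (by linarith) ha
        linarith
    exact exists_monotoneOn_of_moments (p := a) (w := 0) (t := 0) h1 le_rfl (by linarith) le_rfl
      zero_le_one (by ring) (by linarith) (by linarith)
  · obtain ⟨x, rfl⟩ : ∃ x, b = (a - x) / 2 := ⟨a - 2 * b, by ring⟩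
    obtain ⟨y, rfl⟩ : ∃ y, c = (a - x - y) / 6 := ⟨a - x - 6 * c, by ring⟩
    have hx : 0 < x := by linarith
    have hxx : 0 < x ^ 2 := by positivity
    have hxy : x ^ 2 ≤ (1 - a) * y := by linarith
    have hxz : x ^ 2 ≤ a * (x - y) := by linarith
    have hy : 0 < y := pos_of_mul_pos_right (hxx.trans_le hxy) (by linarith)
    have hz : 0 < x - y := pos_of_mul_pos_right (hxx.trans_le hxz) h1
    refine exists_monotoneOn_of_moments (p := a - x ^ 2 / (x - y)) (w := x ^ 3 / (y * (x - y)))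
      (t := y / x) ?_ (by positivity) ?_ (by positivity) ?_ ?_ ?_ ?_
    · rw [sub_nonneg, div_le_iff₀ hz]
      exact hxz
    · have hsum : a - x ^ 2 / (x - y) + x ^ 3 / (y * (x - y)) = a + x ^ 2 / y := by
        field_simp
        ring
      have hle : x ^ 2 / y ≤ 1 - a := by
        rw [div_le_iff₀ hy]
        exact hxy
      linarith
    · rw [div_le_one hx]
      linarith
    all_goals
      field_simp
      ring
end

section
/- For real numbers x, y, z, the system of equations 2y² = 3xz and 6x + 4y² + z² = 6xz + 2yz + 2y holds if and only if (x, y) = (z/6, z/2) or (x, y) = (z³/6, z²/2). -/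
theorem stmt7 (x y z : ℝ) :
    (2 * y ^ 2 = 3 * x * z ∧
      6 * x + 4 * y ^ 2 + z ^ 2 = 6 * x * z + 2 * y * z + 2 * y) ↔
    ((x = z / 6 ∧ y = z / 2) ∨ (x = z ^ 3 / 6 ∧ y = z ^ 2 / 2)) := by
  constructor
  · rintro ⟨h₁, h₂⟩
    have hx : x = (2 * y * z + 2 * y - z ^ 2) / 6 := by linarith
    have hy : (2 * y - z) * (2 * y - z ^ 2) = 0 := by
      rw [hx] at h₁
      linear_combination 2 * h₁
    rcases mul_eq_zero.mp hy with h | h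
    · have hyz : y = z / 2 := by linarith
      exact Or.inl ⟨by rw [hx, hyz]; ring, hyz⟩
    · have hyz : y = z ^ 2 / 2 := by linarith
      exact Or.inr ⟨by rw [hx, hyz]; ring, hyz⟩
  · rintro (⟨rfl, rfl⟩ | ⟨rfl, rfl⟩) <;> constructor <;> ring
end

section
/- Let f : ℝ → ℝ be convex, let a ∈ ℝ, let m be a real number with m ≤ D₊f(a) (the right derivative of f at a), and let c > 0. Define g : ℝ → ℝ by g(x) = m(x−a) + f(a) for x ≤ a + c and g(x) = f(x−c) + mc for x ≥ a + c. Then: (a) g is convex; (b) D₊g(x) ≤ D₊f(x) for all x ≥ a, and f − g is increasing on [a, ∞); (c) if D₊f(x) > m for every x > a, then g(x) < f(x) for all x > a. -/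
open Set

theorem ConvexOn.add_derivWithin_Ici_mul_sub_le {f : ℝ → ℝ} (hf : ConvexOn ℝ univ f) (x y : ℝ) :
    f x + derivWithin f (Ici x) x * (y - x) ≤ f y := by
  have hx : x ∈ interior (univ : Set ℝ) := by simp
  rw [← derivWithin_Ioi_eq_Ici]
  rcases lt_trichotomy x y with h | rfl | h
  · have := hf.rightDeriv_le_slope_of_mem_interior hx (mem_univ y) h
    rw [slope_def_field, le_div_iff₀ (sub_pos.2 h)] at this
    linarith
  · simp
  · have := (hf.slope_le_leftDeriv_of_mem_interior (mem_univ y) hx h).trans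
      (hf.leftDeriv_le_rightDeriv_of_mem_interior hx)
    rw [slope_def_field, div_le_iff₀ (sub_pos.2 h)] at this
    linarith

theorem ConvexOn.monotone_derivWithin_Ici {f : ℝ → ℝ} (hf : ConvexOn ℝ univ f) :
    Monotone fun x => derivWithin f (Ici x) x := by
  intro x y hxy
  have := hf.monotoneOn_rightDeriv (a := x) (b := y) (by simp) (by simp) hxy
  simpa only [derivWithin_Ioi_eq_Ici] using this

theorem convexOn_univ_of_forall_exists_add_mul_sub_le {f : ℝ → ℝ}
    (h : ∀ x, ∃ k, ∀ y, f x + k * (y - x) ≤ f y) : ConvexOn ℝ univ f := by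
  refine ⟨convex_univ, fun x _ y _ s t hs ht hst => ?_⟩
  simp only [smul_eq_mul]
  obtain ⟨k, hk⟩ := h (s * x + t * y)
  have hx := mul_le_mul_of_nonneg_left (hk x) hs
  have hy := mul_le_mul_of_nonneg_left (hk y) ht
  obtain rfl : t = 1 - s := by linarith
  linarith

theorem ConvexOn.sub_sub_le_sub_sub {f : ℝ → ℝ} (hf : ConvexOn ℝ univ f) {x y c : ℝ}
    (hc : 0 < c) (hxy : x ≤ y) : f x - f (x - c) ≤ f y - f (y - c) := by
  have hd : 0 < y - x + c := by linarith
  have hs : 0 ≤ (y - x) / (y - x + c) := div_nonneg (by linarith) hd.le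
  have ht : 0 ≤ c / (y - x + c) := div_nonneg hc.le hd.le
  have hst : (y - x) / (y - x + c) + c / (y - x + c) = 1 := by field_simp
  have h₁ := hf.2 (mem_univ (x - c)) (mem_univ y) hs ht hst
  have h₂ := hf.2 (mem_univ (x - c)) (mem_univ y) ht hs (by rw [add_comm, hst])
  simp only [smul_eq_mul] at h₁ h₂
  rw [show (y - x) / (y - x + c) * (x - c) + c / (y - x + c) * y = x by field_simp; ring] at h₁
  rw [show c / (y - x + c) * (x - c) + (y - x) / (y - x + c) * y = y - c by
    field_simp; ring] at h₂
  rw [← eq_sub_iff_add_eq'] at hst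
  rw [hst] at h₁ h₂
  linarith

theorem stmt10 (f g : ℝ → ℝ) (a m c : ℝ)
    (hf : ConvexOn ℝ univ f)
    (hm : m ≤ derivWithin f (Ici a) a)
    (hc : 0 < c)
    (hg1 : ∀ x ≤ a + c, g x = m * (x - a) + f a)
    (hg2 : ∀ x, a + c ≤ x → g x = f (x - c) + m * c) :
    ConvexOn ℝ univ g ∧
    (∀ x, a ≤ x → derivWithin g (Ici x) x ≤ derivWithin f (Ici x) x) ∧
    MonotoneOn (fun x => f x - g x) (Ici a) ∧
    ((∀ x, a < x → m < derivWithin f (Ici x) x) → ∀ x, a < x → g x < f x) := by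
  have hD : ∀ x, a ≤ x → m ≤ derivWithin f (Ici x) x := fun x hx =>
    hm.trans (hf.monotone_derivWithin_Ici hx)
  have hsub : ∀ x y, a ≤ x → x ≤ y → f x + m * (y - x) ≤ f y := fun x y hx hxy =>
    le_trans (by gcongr; exact hD x hx)
      (hf.add_derivWithin_Ici_mul_sub_le x y)
  have hmono : MonotoneOn (fun x => f x - g x) (Ici a) := by
    have hleft : ∀ x y, a ≤ x → x ≤ y → y ≤ a + c → f x - g x ≤ f y - g y := by
      intro x y hx hxy hy
      rw [hg1 x (hxy.trans hy), hg1 y hy]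
      linarith [hsub x y hx hxy]
    have hright : ∀ x y, a + c ≤ x → x ≤ y → f x - g x ≤ f y - g y := by
      intro x y hx hxy
      rw [hg2 x hx, hg2 y (hx.trans hxy)]
      linarith [hf.sub_sub_le_sub_sub hc hxy]
    intro x hx y _ hxy
    rcases le_total y (a + c) with hy | hy
    · exact hleft x y hx hxy hy
    rcases le_total x (a + c) with hx' | hx'
    · exact (hleft x _ hx hx' le_rfl).trans (hright _ y le_rfl hy)
    · exact hright x y hx' hxy
  refine ⟨convexOn_univ_of_forall_exists_add_mul_sub_le fun x => ?_, fun x hx => ?_, hmono,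
    fun hlt x hx => ?_⟩
  · rcases le_total (a + c) x with hx | hx
    · refine ⟨derivWithin f (Ici (x - c)) (x - c), fun y => ?_⟩
      rw [hg2 x hx]
      rcases le_total (a + c) y with hy | hy
      · rw [hg2 y hy]
        linarith [hf.add_derivWithin_Ici_mul_sub_le (x - c) (y - c)]
      · rw [hg1 y hy]
        have := hf.add_derivWithin_Ici_mul_sub_le (x - c) a
        have := mul_nonneg (sub_nonneg.2 (hD (x - c) (by linarith))) (sub_nonneg.2 hy)
        linarith
    · refine ⟨m, fun y => ?_⟩
      rw [hg1 x hx]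
      rcases le_total (a + c) y with hy | hy
      · rw [hg2 y hy]
        linarith [hsub a (y - c) le_rfl (by linarith)]
      · rw [hg1 y hy]
        linarith
  · rcases le_or_gt (a + c) x with h | h
    · have : derivWithin g (Ici x) x = derivWithin f (Ici (x - c)) (x - c) := by
        rw [derivWithin_congr (fun y (hy : y ∈ Ici x) => hg2 y (h.trans hy)) (hg2 x h),
          derivWithin_add_const, derivWithin_comp_sub_const]
        simp [← image_vadd, sub_eq_neg_add]
      rw [this]
      exact hf.monotone_derivWithin_Ici (by linarith)
    · have hd : HasDerivAt g m x := by
        have : HasDerivAt (fun y => m * (y - a) + f a) m x := by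
          simpa using (((hasDerivAt_id x).sub_const a).const_mul m).add_const (f a)
        exact this.congr_of_eventuallyEq
          ((eventually_lt_nhds h).mono fun y hy => hg1 y hy.le)
      rw [hd.hasDerivWithinAt.derivWithin (uniqueDiffWithinAt_Ici x)]
      exact hD x hx
  · have key : ∀ y, a < y → y ≤ a + c → g y < f y := by
      intro y hy hyc
      obtain ⟨z, haz, hzy⟩ := exists_between hy
      rw [hg1 y hyc]
      have h₁ := hsub a z le_rfl haz.le
      have h₂ := hf.add_derivWithin_Ici_mul_sub_le z y
      have h₃ := mul_pos (sub_pos.2 (hlt z haz)) (sub_pos.2 hzy)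
      linarith
    rcases le_total x (a + c) with h | h
    · exact key x hx h
    · have h₁ := key (a + c) (by linarith) le_rfl
      have h₂ := hmono (mem_Ici.2 (by linarith : a ≤ a + c)) (mem_Ici.2 hx.le) h
      simp only at h₂
      linarith
end

section
/- Let X be a topological space and let Y and Z be linearly ordered sets with their order topology. Let E ⊆ X × Y be such that each horizontal section E^y = {x : (x,y) ∈ E} is open in X and each vertical section E_x = {y : (x,y) ∈ E} is order-convex (an interval) in Y. Let f be a function defined on E with values in Z, continuous in the first variable (for each y, x ↦ f(x,y) is continuous on E^y) and strictly increasing in the second variable (for each x, y ↦ f(x,y) is strictly increasing on E_x). Let a ∈ Z and let X₀ = {x ∈ X : E_x ≠ ∅}. Suppose φ : X₀ → Y is a function such that for each x ∈ X₀: (x, φ(x)) ∈ E, φ(x) is not an endpoint of E_x (i.e., there exist y', y'' ∈ E_x with y' < φ(x) < y''), and f(x, φ(x)) = a. Then φ is continuous on X₀. -/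
open Set

theorem stmt11 {X Y Z : Type*} [TopologicalSpace X]
    [LinearOrder Y] [TopologicalSpace Y] [OrderTopology Y]
    [LinearOrder Z] [TopologicalSpace Z] [OrderTopology Z]
    (E : Set (X × Y))
    (hEopen : ∀ y : Y, IsOpen {x : X | (x, y) ∈ E})
    (hEconv : ∀ (x : X) (y₁ y₂ y : Y),
      (x, y₁) ∈ E → (x, y₂) ∈ E → y₁ ≤ y → y ≤ y₂ → (x, y) ∈ E)
    (f : X → Y → Z)
    (hfc : ∀ y : Y, ContinuousOn (fun x => f x y) {x : X | (x, y) ∈ E})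
    (hfm : ∀ x : X, StrictMonoOn (f x) {y : Y | (x, y) ∈ E})
    (a : Z) (φ : X → Y)
    (hφE : ∀ x ∈ {x : X | ∃ y, (x, y) ∈ E}, (x, φ x) ∈ E)
    (hφlt : ∀ x ∈ {x : X | ∃ y, (x, y) ∈ E}, ∃ y', (x, y') ∈ E ∧ y' < φ x)
    (hφgt : ∀ x ∈ {x : X | ∃ y, (x, y) ∈ E}, ∃ y'', (x, y'') ∈ E ∧ φ x < y'')
    (hφa : ∀ x ∈ {x : X | ∃ y, (x, y) ∈ E}, f x (φ x) = a) :
    ContinuousOn φ {x : X | ∃ y, (x, y) ∈ E} := by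
  intro x₀ hx₀
  refine tendsto_order.2 ⟨fun c hc => ?_, fun c hc => ?_⟩
  · obtain ⟨y, hyE, hy⟩ := hφlt x₀ hx₀
    have hm : max c y < φ x₀ := max_lt hc hy
    have hmE : (x₀, max c y) ∈ E :=
      hEconv x₀ y (φ x₀) _ hyE (hφE x₀ hx₀) (le_max_right _ _) hm.le
    have hfa : f x₀ (max c y) < a := hφa x₀ hx₀ ▸ hfm x₀ hmE (hφE x₀ hx₀) hm
    have hnhds := (hEopen (max c y)).mem_nhds hmE
    have hcont := (hfc (max c y)).continuousAt hnhds
    filter_upwards [mem_nhdsWithin_of_mem_nhds hnhds,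
      mem_nhdsWithin_of_mem_nhds (hcont.eventually_lt_const hfa),
      self_mem_nhdsWithin] with x hxE hxa hx
    rw [← hφa x hx] at hxa
    exact (le_max_left _ _).trans_lt (((hfm x).lt_iff_lt hxE (hφE x hx)).1 hxa)
  · obtain ⟨y, hyE, hy⟩ := hφgt x₀ hx₀
    have hm : φ x₀ < min c y := lt_min hc hy
    have hmE : (x₀, min c y) ∈ E :=
      hEconv x₀ (φ x₀) y _ (hφE x₀ hx₀) hyE hm.le (min_le_right _ _)
    have hfa : a < f x₀ (min c y) := hφa x₀ hx₀ ▸ hfm x₀ (hφE x₀ hx₀) hmE hm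
    have hnhds := (hEopen (min c y)).mem_nhds hmE
    have hcont := (hfc (min c y)).continuousAt hnhds
    filter_upwards [mem_nhdsWithin_of_mem_nhds hnhds,
      mem_nhdsWithin_of_mem_nhds (hcont.eventually_const_lt hfa),
      self_mem_nhdsWithin] with x hxE hxa hx
    rw [← hφa x hx] at hxa
    exact (((hfm x).lt_iff_lt (hφE x hx) hxE).1 hxa).trans_le (min_le_left _ _)
end

section
/- Let (α_j)_{j≥0} be a sequence of real numbers with α₀ = 0 and such that either α_j = 0 for all j ≥ 1, or the least j ≥ 1 with α_j ≠ 0 satisfies α_j > 0. Let δ > 0. Then there exists a C^∞ function σ : ℝ → ℝ such that D^j σ(0) = α_j for all j ≥ 0, σ'(x) > 0 for all x > 0, and σ(x) = x for all x ≥ δ/2. -/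
open Set

open scoped ContDiff Topology

/-- A compactly supported smooth function whose Taylor series at `0` is that of `x ^ n / n!`. -/
theorem exists_hasCompactSupport_iteratedDeriv_zero_eq_ite (n : ℕ) :
    ∃ h : ℝ → ℝ, ContDiff ℝ ∞ h ∧ HasCompactSupport h ∧
      ∀ k : ℕ, iteratedDeriv k h 0 = if k = n then 1 else 0 := by
  let φ : ContDiffBump (0 : ℝ) := ⟨1, 2, one_pos, one_lt_two⟩
  refine ⟨fun x ↦ x ^ n / n.factorial * φ x, ?_, φ.hasCompactSupport.mul_left, fun k ↦ ?_⟩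
  · exact ((contDiff_id.pow n).div_const _).mul φ.contDiff
  · have h : (fun x : ℝ ↦ x ^ n / n.factorial * φ x) =ᶠ[𝓝 0] fun x ↦ x ^ n / n.factorial := by
      filter_upwards [φ.eventuallyEq_one] with x hx
      simp [hx]
    rw [h.iteratedDeriv_eq k, iteratedDeriv_div_const, iteratedDeriv_fun_pow_zero]
    split_ifs
    · exact div_self (by positivity)
    · simp

/-- **Borel's lemma**: every real sequence is the sequence of derivatives at `0` of a smooth
function. -/
theorem exists_contDiff_iteratedDeriv_zero_eq (a : ℕ → ℝ) :
    ∃ f : ℝ → ℝ, ContDiff ℝ ∞ f ∧ ∀ k : ℕ, iteratedDeriv k f 0 = a k := by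
  choose h h_smooth h_supp h_deriv using exists_hasCompactSupport_iteratedDeriv_zero_eq_ite
  have h_bound (n k : ℕ) : ∃ C : ℝ, ∀ x, ‖iteratedDeriv k (h n) x‖ ≤ C := by
    obtain ⟨C, hC⟩ := ((h_supp n).iteratedFDeriv (𝕜 := ℝ) k).exists_bound_of_continuous
      ((h_smooth n).continuous_iteratedFDeriv (mod_cast le_top))
    exact ⟨C, fun x ↦ norm_iteratedFDeriv_eq_norm_iteratedDeriv.symm.trans_le (hC x)⟩
  choose M hM using h_bound
  have hM0 (n k : ℕ) : 0 ≤ M n k := (norm_nonneg _).trans (hM n k 0)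
  let t (n : ℕ) : ℝ := 1 + 2 ^ n * (|a n| * ∑ k ∈ Finset.range n, M n k)
  have ht_nonneg (n : ℕ) : 0 ≤ 2 ^ n * (|a n| * ∑ k ∈ Finset.range n, M n k) :=
    mul_nonneg (by positivity)
      (mul_nonneg (abs_nonneg _) (Finset.sum_nonneg fun k _ ↦ hM0 n k))
  have ht1 (n : ℕ) : 1 ≤ t n := le_add_of_nonneg_right (ht_nonneg n)
  have ht0 (n : ℕ) : 0 < t n := one_pos.trans_le (ht1 n)
  let F (n : ℕ) (x : ℝ) : ℝ := a n / t n ^ n * h n (t n * x)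
  have hF (n : ℕ) : ContDiff ℝ ∞ (F n) :=
    contDiff_const.mul ((h_smooth n).comp (contDiff_const.mul contDiff_id))
  have hF_deriv (n k : ℕ) (x : ℝ) :
      iteratedDeriv k (F n) x = a n / t n ^ n * (t n ^ k * iteratedDeriv k (h n) (t n * x)) := by
    rw [iteratedDeriv_const_mul_field,
      iteratedDeriv_comp_const_mul ((h_smooth n).of_le (mod_cast le_top))]
  let v (k n : ℕ) : ℝ := |a n| / t n ^ n * (t n ^ k * M n k)
  have hv_nonneg (k n : ℕ) : 0 ≤ v k n :=
    mul_nonneg (div_nonneg (abs_nonneg _) (pow_nonneg (ht0 n).le _))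
      (mul_nonneg (pow_nonneg (ht0 n).le _) (hM0 n k))
  have hv_le (k n : ℕ) (hkn : k < n) : v k n ≤ (1 / 2) ^ n := by
    have h1 : t n ^ k * t n ≤ t n ^ n := by
      rw [← pow_succ]
      exact pow_le_pow_right₀ (ht1 n) hkn
    have h2 : M n k ≤ ∑ k ∈ Finset.range n, M n k :=
      Finset.single_le_sum (fun i _ ↦ hM0 n i) (Finset.mem_range.2 hkn)
    have h3 : 2 ^ n * (|a n| * M n k) ≤ t n := by
      have : 2 ^ n * (|a n| * M n k) ≤ 2 ^ n * (|a n| * ∑ k ∈ Finset.range n, M n k) := by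
        gcongr
      linarith
    have h4 : v k n = |a n| * M n k * t n ^ k / t n ^ n := by
      simp only [v]
      ring
    rw [h4, div_le_iff₀ (pow_pos (ht0 n) n), one_div, inv_pow, inv_mul_eq_div,
      le_div_iff₀ (by positivity)]
    calc |a n| * M n k * t n ^ k * 2 ^ n = t n ^ k * (2 ^ n * (|a n| * M n k)) := by ring
      _ ≤ t n ^ k * t n := by gcongr; exact pow_nonneg (ht0 n).le k
      _ ≤ t n ^ n := h1
  have hv (k : ℕ) : Summable (v k) := by
    refine .of_norm_bounded_eventually_nat summable_geometric_two ?_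
    filter_upwards [Filter.eventually_gt_atTop k] with n hn
    rw [Real.norm_of_nonneg (hv_nonneg k n)]
    exact hv_le k n hn
  have hFv (k n : ℕ) (x : ℝ) : ‖iteratedFDeriv ℝ k (F n) x‖ ≤ v k n := by
    rw [norm_iteratedFDeriv_eq_norm_iteratedDeriv, hF_deriv, norm_mul, norm_mul, norm_div,
      Real.norm_eq_abs (a n), Real.norm_of_nonneg (pow_nonneg (ht0 n).le n),
      Real.norm_of_nonneg (pow_nonneg (ht0 n).le k)]
    have := ht0 n
    simp only [v]
    gcongr
    exact hM n k _
  refine ⟨fun x ↦ ∑' n, F n x,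
    contDiff_tsum (N := ⊤) hF (fun k _ ↦ hv k) (fun k n x _ ↦ hFv k n x), fun k ↦ ?_⟩
  have h_sum : Summable fun n ↦ iteratedFDeriv ℝ k (F n) 0 :=
    .of_norm_bounded (hv k) fun n ↦ hFv k n 0
  rw [iteratedDeriv_eq_iteratedFDeriv, iteratedFDeriv_tsum_apply (N := ⊤) hF (fun k _ ↦ hv k)
    (fun k n x _ ↦ hFv k n x) le_top, ContinuousMultilinearMap.tsum_eval h_sum]
  simp only [← iteratedDeriv_eq_iteratedFDeriv, hF_deriv, mul_zero, h_deriv]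
  rw [tsum_eq_single k fun n hn ↦ by simp [hn.symm]]
  have := (ht0 k).ne'
  simp
  field_simp

/-- A smooth function whose first nonzero derivative at `0` is positive is nonnegative on a right
neighbourhood of `0`. -/
theorem exists_nonneg_Icc_of_iteratedDeriv_pos (k : ℕ) {f : ℝ → ℝ} (hf : ContDiff ℝ ∞ f)
    (h_zero : ∀ j < k, iteratedDeriv j f 0 = 0) (h_pos : 0 < iteratedDeriv k f 0) :
    ∃ η > 0, ∀ x ∈ Icc 0 η, 0 ≤ f x := by
  induction k generalizing f with
  | zero =>
    rw [iteratedDeriv_zero] at h_pos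
    obtain ⟨η, hη, h⟩ := Metric.eventually_nhds_iff.1
      (hf.continuous.continuousAt.eventually (lt_mem_nhds h_pos))
    refine ⟨η / 2, half_pos hη, fun x hx ↦ (h ?_).le⟩
    rw [Real.dist_eq, sub_zero, abs_of_nonneg hx.1]
    linarith [hx.2]
  | succ k ih =>
    obtain ⟨hf_diff, hf'⟩ := contDiff_infty_iff_deriv.1 hf
    obtain ⟨η, hη, h⟩ := ih hf'
      (fun j hj ↦ by rw [← iteratedDeriv_succ']; exact h_zero _ (by omega))
      (by rwa [← iteratedDeriv_succ'])
    refine ⟨η, hη, fun x hx ↦ ?_⟩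
    have h_mono : MonotoneOn f (Icc 0 η) :=
      monotoneOn_of_deriv_nonneg (convex_Icc _ _) hf.continuous.continuousOn
        hf_diff.differentiableOn fun y hy ↦ h y (interior_subset hy)
    have h0 : f 0 = 0 := by simpa using h_zero 0 k.succ_pos
    exact h0.symm.trans_le (h_mono ⟨le_rfl, hη.le⟩ hx hx.1)

/-- Smooth functions that agree on `(-∞, a]` have the same derivatives at `a`. -/
theorem iteratedDeriv_eq_of_eqOn_Iic {f g : ℝ → ℝ} (hf : ContDiff ℝ ∞ f) (hg : ContDiff ℝ ∞ g)
    {a : ℝ} (h : EqOn f g (Iic a)) (k : ℕ) : iteratedDeriv k f a = iteratedDeriv k g a := by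
  rw [← iteratedDerivWithin_eq_iteratedDeriv (uniqueDiffOn_Iic a)
      (hf.of_le (mod_cast le_top)).contDiffAt self_mem_Iic,
    ← iteratedDerivWithin_eq_iteratedDeriv (uniqueDiffOn_Iic a)
      (hg.of_le (mod_cast le_top)).contDiffAt self_mem_Iic]
  exact iteratedDerivWithin_congr h self_mem_Iic

/-- The product of a continuous function with a smooth cutoff vanishing beyond a small `ε`
has small integral. -/
theorem exists_integral_mul_one_sub_smoothTransition_le {f : ℝ → ℝ} (hf : Continuous f)
    {η d r : ℝ} (hη : 0 < η) (hd : 0 < d) (hr : 0 < r) :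
    ∃ ε > 0, ε ≤ η ∧ ε ≤ d ∧
      ∫ x in (0 : ℝ)..d, f x * (1 - Real.smoothTransition (x / ε)) ≤ r := by
  obtain ⟨C, hC⟩ := isCompact_Icc.exists_bound_of_continuousOn (hf.continuousOn (s := Icc 0 d))
  have hC0 : 0 ≤ C := (norm_nonneg _).trans (hC 0 ⟨le_rfl, hd.le⟩)
  obtain ⟨ε, hε, hεη, hεd, hεr⟩ : ∃ ε > 0, ε ≤ η ∧ ε ≤ d ∧ ε ≤ r / (C + 1) :=
    ⟨min η (min d (r / (C + 1))), by positivity, by simp, by simp, by simp⟩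
  refine ⟨ε, hε, hεη, hεd, ?_⟩
  have h_cont : Continuous fun x ↦ f x * (1 - Real.smoothTransition (x / ε)) :=
    hf.mul (continuous_const.sub
      (Real.smoothTransition.continuous.comp (continuous_id.div_const ε)))
  have h_zero : ∫ x in ε..d, f x * (1 - Real.smoothTransition (x / ε)) = 0 := by
    rw [intervalIntegral.integral_congr (g := fun _ ↦ 0), intervalIntegral.integral_zero]
    intro x hx
    rw [uIcc_of_le hεd] at hx
    simp [Real.smoothTransition.one_of_one_le ((one_le_div hε).2 hx.1)]
  rw [← intervalIntegral.integral_add_adjacent_intervals (h_cont.intervalIntegrable 0 ε)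
    (h_cont.intervalIntegrable ε d), h_zero, add_zero]
  have h_le : ‖∫ x in (0 : ℝ)..ε, f x * (1 - Real.smoothTransition (x / ε))‖ ≤ C * |ε - 0| := by
    refine intervalIntegral.norm_integral_le_of_norm_le_const fun x hx ↦ ?_
    rw [uIoc_of_le hε.le] at hx
    rw [norm_mul, Real.norm_of_nonneg (sub_nonneg.2 (Real.smoothTransition.le_one _))]
    exact (mul_le_of_le_one_right (norm_nonneg _)
      (by linarith [Real.smoothTransition.nonneg (x / ε)])).trans
      (hC x ⟨hx.1.le, hx.2.trans hεd⟩)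
  rw [sub_zero, abs_of_pos hε] at h_le
  rw [le_div_iff₀ (by positivity)] at hεr
  linarith [Real.le_norm_self (∫ x in (0 : ℝ)..ε, f x * (1 - Real.smoothTransition (x / ε)))]

/-- A smooth function that is nonnegative on a right neighbourhood of `0` can be modified on
`(0, ∞)` to be positive there, equal to `1` beyond `d`, and of mean `1` on `[0, d]`. -/
theorem exists_contDiff_pos_integral_eq {f : ℝ → ℝ} (hf : ContDiff ℝ ∞ f) {η d : ℝ}
    (hη : 0 < η) (hf_nonneg : ∀ x ∈ Icc 0 η, 0 ≤ f x) (hd : 0 < d) :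
    ∃ g : ℝ → ℝ, ContDiff ℝ ∞ g ∧ EqOn g f (Iic 0) ∧ (∀ x, 0 < x → 0 < g x) ∧
      (∀ x, d ≤ x → g x = 1) ∧ ∫ x in (0 : ℝ)..d, g x = d := by
  let S (ε x : ℝ) : ℝ := Real.smoothTransition (x / ε)
  have hS (ε : ℝ) : ContDiff ℝ ∞ (S ε) :=
    Real.smoothTransition.contDiff.comp (contDiff_id.div_const ε)
  have hS_nonneg (ε x : ℝ) : 0 ≤ S ε x := Real.smoothTransition.nonneg _
  have hS_le (ε x : ℝ) : S ε x ≤ 1 := Real.smoothTransition.le_one _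
  have hS_pos {ε x : ℝ} (hε : 0 < ε) (hx : 0 < x) : 0 < S ε x :=
    Real.smoothTransition.pos_of_pos (div_pos hx hε)
  have hS_zero {ε x : ℝ} (hε : 0 < ε) (hx : x ≤ 0) : S ε x = 0 :=
    Real.smoothTransition.zero_of_nonpos (div_nonpos_of_nonpos_of_nonneg hx hε.le)
  have hS_one {ε x : ℝ} (hε : 0 < ε) (hx : ε ≤ x) : S ε x = 1 :=
    Real.smoothTransition.one_of_one_le ((one_le_div hε).2 hx)
  have hS_lt {x : ℝ} (hx : x < d) : S d x < 1 :=
    Real.smoothTransition.lt_one_of_lt_one ((div_lt_one hd).2 hx)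
  have hψ : ContDiff ℝ ∞ fun x ↦ S d x * (1 - S d x) := (hS d).mul (contDiff_const.sub (hS d))
  have h_gap : 0 < ∫ x in (0 : ℝ)..d, (1 - S d x) :=
    intervalIntegral.intervalIntegral_pos_of_pos_on
      ((continuous_const.sub (hS d).continuous).intervalIntegrable _ _)
      (fun x hx ↦ sub_pos.2 (hS_lt hx.2)) hd
  have h_bump : 0 < ∫ x in (0 : ℝ)..d, S d x * (1 - S d x) :=
    intervalIntegral.intervalIntegral_pos_of_pos_on (hψ.continuous.intervalIntegrable _ _)
      (fun x hx ↦ mul_pos (hS_pos hd hx.1) (sub_pos.2 (hS_lt hx.2))) hd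
  obtain ⟨ε, hε, hεη, hεd, h_int⟩ :=
    exists_integral_mul_one_sub_smoothTransition_le hf.continuous hη hd h_gap
  change ∫ x in (0 : ℝ)..d, f x * (1 - S ε x) ≤ _ at h_int
  have hχ : ContDiff ℝ ∞ fun x ↦ f x * (1 - S ε x) := hf.mul (contDiff_const.sub (hS ε))
  set I := ∫ x in (0 : ℝ)..d, f x * (1 - S ε x) with hI
  set r := ∫ x in (0 : ℝ)..d, (1 - S d x) with hr
  set J := ∫ x in (0 : ℝ)..d, S d x * (1 - S d x) with hJ
  have hc : 0 ≤ (r - I) / J := div_nonneg (sub_nonneg.2 h_int) h_bump.le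
  refine ⟨fun x ↦ f x * (1 - S ε x) + S d x + (r - I) / J * (S d x * (1 - S d x)),
    (hχ.add (hS d)).add (contDiff_const.mul hψ), fun x hx ↦ ?_, fun x hx ↦ ?_, fun x hx ↦ ?_, ?_⟩
  · simp [hS_zero hε hx, hS_zero hd hx]
  · have h1 : 0 ≤ f x * (1 - S ε x) := by
      rcases le_total x ε with hxε | hxε
      · exact mul_nonneg (hf_nonneg x ⟨hx.le, hxε.trans hεη⟩) (sub_nonneg.2 (hS_le _ _))
      · simp [hS_one hε hxε]
    have h2 := mul_nonneg hc (mul_nonneg (hS_nonneg d x) (sub_nonneg.2 (hS_le d x)))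
    have h3 := hS_pos hd hx
    linarith
  · simp [hS_one hε (hεd.trans hx), hS_one hd hx]
  · have hr' : r = d - ∫ x in (0 : ℝ)..d, S d x := by
      rw [hr, intervalIntegral.integral_sub (continuous_const.intervalIntegrable _ _)
        ((hS d).continuous.intervalIntegrable _ _)]
      simp
    rw [intervalIntegral.integral_add ((hχ.add (hS d)).continuous.intervalIntegrable _ _)
        ((contDiff_const.mul hψ).continuous.intervalIntegrable _ _),
      intervalIntegral.integral_add (hχ.continuous.intervalIntegrable _ _)
        ((hS d).continuous.intervalIntegrable _ _),
      intervalIntegral.integral_const_mul, ← hI, ← hJ, div_mul_cancel₀ _ h_bump.ne']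
    linarith

theorem stmt13 (α : ℕ → ℝ) (hα0 : α 0 = 0)
    (hα : (∀ j, 1 ≤ j → α j = 0) ∨
      (∃ j, 1 ≤ j ∧ (∀ i, 1 ≤ i → i < j → α i = 0) ∧ 0 < α j))
    (δ : ℝ) (hδ : 0 < δ) :
    ∃ σ : ℝ → ℝ, ContDiff ℝ (⊤ : ℕ∞) σ ∧
      (∀ j : ℕ, iteratedDeriv j σ 0 = α j) ∧
      (∀ x : ℝ, 0 < x → 0 < deriv σ x) ∧
      (∀ x : ℝ, δ / 2 ≤ x → σ x = x) := by
  obtain ⟨f, hf, hfα, η, hη, hf_nonneg⟩ : ∃ f : ℝ → ℝ, ContDiff ℝ ∞ f ∧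
      (∀ k, iteratedDeriv k f 0 = α (k + 1)) ∧ ∃ η > 0, ∀ x ∈ Icc 0 η, 0 ≤ f x := by
    rcases hα with hα | ⟨j, hj, h_zero, h_pos⟩
    · exact ⟨fun _ ↦ 0, contDiff_const, fun k ↦ by simp [hα (k + 1)],
        1, one_pos, fun _ _ ↦ le_rfl⟩
    · obtain ⟨f, hf, hfα⟩ := exists_contDiff_iteratedDeriv_zero_eq fun k ↦ α (k + 1)
      refine ⟨f, hf, hfα, exists_nonneg_Icc_of_iteratedDeriv_pos (j - 1) hf (fun i hi ↦ ?_) ?_⟩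
      · rw [hfα]
        exact h_zero _ (by omega) (by omega)
      · rwa [hfα, Nat.sub_add_cancel hj]
  obtain ⟨g, hg, hgf, hg_pos, hg_one, hg_int⟩ :=
    exists_contDiff_pos_integral_eq hf hη hf_nonneg (half_pos hδ)
  have hσ (x : ℝ) : HasDerivAt (fun y ↦ ∫ t in (0 : ℝ)..y, g t) (g x) x :=
    hg.continuous.integral_hasStrictDerivAt 0 x |>.hasDerivAt
  have hσ' : deriv (fun y ↦ ∫ t in (0 : ℝ)..y, g t) = g := funext fun x ↦ (hσ x).deriv
  refine ⟨fun y ↦ ∫ t in (0 : ℝ)..y, g t,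
    contDiff_infty_iff_deriv.2 ⟨fun x ↦ (hσ x).differentiableAt, by rwa [hσ']⟩,
    fun j ↦ ?_, fun x hx ↦ by rw [hσ']; exact hg_pos x hx, fun x hx ↦ ?_⟩
  · cases j with
    | zero => simp [hα0]
    | succ k => rw [iteratedDeriv_succ', hσ', iteratedDeriv_eq_of_eqOn_Iic hg hf hgf, hfα]
  · have h_one : ∫ t in (δ / 2)..x, g t = x - δ / 2 := by
      rw [intervalIntegral.integral_congr (g := fun _ ↦ 1), integral_one]
      intro t ht
      rw [uIcc_of_le hx] at ht
      exact hg_one t ht.1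
    beta_reduce
    rw [← intervalIntegral.integral_add_adjacent_intervals
      (hg.continuous.intervalIntegrable 0 (δ / 2)) (hg.continuous.intervalIntegrable (δ / 2) x),
      hg_int, h_one]
    ring
end

section
/- Let (α_j)_{j≥0} and (β_j)_{j≥0} be sequences of real numbers such that α₀ < β₀, either α_j = 0 for all j ≥ 1 or the least j ≥ 1 with α_j ≠ 0 satisfies α_j > 0, and either β_j = 0 for all j ≥ 1 or the least j ≥ 1 with β_j ≠ 0 satisfies (−1)^{j+1}β_j > 0. Then for any real numbers a < b, there exists a C^∞ function f : ℝ → ℝ such that f'(x) > 0 for all x ∈ (a,b), and D^j f(a) = α_j and D^j f(b) = β_j for all j ≥ 1. -/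
open Set

open Filter Topology

/-- **Borel's lemma**: every real sequence is the sequence of derivatives at `0` of a smooth
function. -/
theorem exists_contDiff_iteratedDeriv_zero_eq_s14 (c : ℕ → ℝ) :
    ∃ h : ℝ → ℝ, ContDiff ℝ (⊤ : ℕ∞) h ∧ ∀ n, iteratedDeriv n h 0 = c n := by
  let φ : ContDiffBump (0 : ℝ) := ⟨1, 2, one_pos, one_lt_two⟩
  let ψ : ℕ → ℝ → ℝ := fun n x => x ^ n * φ x
  have hψ : ∀ n, ContDiff ℝ (⊤ : ℕ∞) (ψ n) := fun n => (contDiff_id.pow n).mul φ.contDiff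
  have hbound : ∀ n k, ∃ M, ∀ x, ‖iteratedFDeriv ℝ k (ψ n) x‖ ≤ M := fun n k =>
    (HasCompactSupport.iteratedFDeriv φ.hasCompactSupport.mul_left k).exists_bound_of_continuous
      ((hψ n).continuous_iteratedFDeriv (by exact_mod_cast le_top))
  choose M hM using hbound
  have hM0 : ∀ n k, 0 ≤ M n k := fun n k => (norm_nonneg _).trans (hM n k 0)
  let d : ℕ → ℝ := fun n => c n / n.factorial
  let R : ℕ → ℝ := fun n => 1 + 2 ^ n * |d n| * ∑ k ∈ Finset.range n, M n k
  have hR1 : ∀ n, 1 ≤ R n := fun n => le_add_of_nonneg_right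
    (mul_nonneg (by positivity) (Finset.sum_nonneg fun k _ => hM0 n k))
  have hR0 : ∀ n, 0 < R n := fun n => one_pos.trans_le (hR1 n)
  have hRM : ∀ n k, k < n → 2 ^ n * |d n| * M n k ≤ R n := fun n k hk => by
    have h1 : M n k ≤ ∑ k ∈ Finset.range n, M n k :=
      Finset.single_le_sum (fun k _ => hM0 n k) (Finset.mem_range.2 hk)
    have h2 : 2 ^ n * |d n| * M n k ≤ 2 ^ n * |d n| * ∑ k ∈ Finset.range n, M n k := by gcongr
    exact h2.trans (le_add_of_nonneg_left zero_le_one)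
  let t : ℕ → ℝ → ℝ := fun n x => d n / R n ^ n * ψ n (R n * x)
  have ht : ∀ n, ContDiff ℝ (⊤ : ℕ∞) (t n) := fun n =>
    contDiff_const.mul ((hψ n).comp (contDiff_const.mul contDiff_id))
  let v : ℕ → ℕ → ℝ := fun k n => |d n| / R n ^ n * (R n ^ k * M n k)
  have hv0 : ∀ k n, 0 ≤ v k n := fun k n =>
    mul_nonneg (div_nonneg (abs_nonneg _) (pow_nonneg (hR0 n).le _))
      (mul_nonneg (pow_nonneg (hR0 n).le _) (hM0 n k))
  have htv : ∀ k n x, ‖iteratedFDeriv ℝ k (t n) x‖ ≤ v k n := fun k n x => by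
    rw [norm_iteratedFDeriv_eq_norm_iteratedDeriv, iteratedDeriv_const_mul_field,
      iteratedDeriv_comp_const_mul ((hψ n).of_le (by exact_mod_cast le_top)), norm_mul, norm_mul,
      ← norm_iteratedFDeriv_eq_norm_iteratedDeriv, norm_div, norm_pow, norm_pow,
      Real.norm_of_nonneg (hR0 n).le, Real.norm_eq_abs]
    have := hR0 n
    have := hM n k (R n * x)
    simp only [v]
    gcongr
  have hv : ∀ k, Summable (v k) := fun k => by
    refine Summable.of_norm_bounded_eventually_nat summable_geometric_two ?_
    filter_upwards [eventually_gt_atTop k] with n hn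
    rw [Real.norm_of_nonneg (hv0 k n)]
    have hRn := hR0 n
    have h1 : R n ^ (k + 1) ≤ R n ^ n := pow_le_pow_right₀ (hR1 n) hn
    have h2 : |d n| * M n k ≤ (1 / 2) ^ n * R n := by
      rw [one_div, inv_pow, ← div_eq_inv_mul, le_div_iff₀ (by positivity)]
      linarith [hRM n k hn]
    calc v k n = |d n| * M n k * R n ^ k / R n ^ n := by simp only [v]; ring
      _ ≤ (1 / 2) ^ n * R n * R n ^ k / R n ^ n := by gcongr
      _ = (1 / 2) ^ n * (R n ^ (k + 1) / R n ^ n) := by ring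
      _ ≤ (1 / 2) ^ n * 1 := by gcongr; exact (div_le_one (by positivity)).2 h1
      _ = (1 / 2) ^ n := mul_one _
  have ht0 : ∀ k n, iteratedDeriv k (t n) 0 = if n = k then c n else 0 := fun k n => by
    have hev : t n =ᶠ[𝓝 0] fun x => d n * x ^ n := by
      have hlim : Tendsto (fun x => R n * x) (𝓝 0) (𝓝 0) :=
        (continuous_const.mul continuous_id).tendsto' 0 0 (mul_zero _)
      filter_upwards [hlim.eventually φ.eventuallyEq_one] with x hx
      have := (hR0 n).ne'
      simp only [t, ψ, hx, Pi.one_apply, mul_pow]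
      field_simp
    rw [hev.iteratedDeriv_eq, iteratedDeriv_const_mul_field, iteratedDeriv_fun_pow_zero]
    have hfac : (n.factorial : ℝ) ≠ 0 := by positivity
    by_cases h : n = k
    · simp [h, d]
      subst h
      field_simp
    · simp [h, Ne.symm h]
  refine ⟨fun x => ∑' n, t n x, contDiff_tsum (v := v) ht (fun k _ => hv k)
    (fun k n x _ => htv k n x), fun k => ?_⟩
  have hsum : Summable fun n => iteratedFDeriv ℝ k (t n) 0 :=
    Summable.of_norm_bounded (hv k) fun n => htv k n 0
  rw [iteratedDeriv_eq_iteratedFDeriv, iteratedFDeriv_tsum_apply (v := v) (N := ⊤) ht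
    (fun k _ => hv k) (fun k n x _ => htv k n x) le_top,
    ContinuousMultilinearMap.tsum_eval hsum]
  simp_rw [← iteratedDeriv_eq_iteratedFDeriv, ht0]
  exact tsum_ite_eq k c

theorem iteratedDeriv_expNegInvGlue_zero (n : ℕ) : iteratedDeriv n expNegInvGlue 0 = 0 := by
  have hcont : Continuous (iteratedDeriv n expNegInvGlue) :=
    (expNegInvGlue.contDiff (n := n)).continuous_iteratedDeriv n le_rfl
  have heq : EqOn (iteratedDeriv n expNegInvGlue) 0 (Iio 0) := fun x hx => by
    have : expNegInvGlue =ᶠ[nhds x] fun _ => (0 : ℝ) := by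
      filter_upwards [Iio_mem_nhds hx] with y hy
      exact expNegInvGlue.zero_of_nonpos (le_of_lt hy)
    rw [this.iteratedDeriv_eq]
    simp
  exact heq.closure hcont continuous_const (by simp)

theorem eventually_pos_of_iteratedDeriv_pos (m : ℕ) {h : ℝ → ℝ} (hh : ContDiff ℝ (⊤ : ℕ∞) h)
    (hzero : ∀ i < m, iteratedDeriv i h 0 = 0) (hpos : 0 < iteratedDeriv m h 0) :
    ∀ᶠ x in 𝓝[>] 0, 0 < h x := by
  induction m generalizing h with
  | zero =>
    rw [iteratedDeriv_zero] at hpos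
    exact (hh.continuous.continuousAt.eventually_const_lt hpos).filter_mono nhdsWithin_le_nhds
  | succ m ih =>
    have hderiv : ∀ᶠ x in 𝓝[>] 0, 0 < deriv h x := by
      refine ih (contDiff_infty_iff_deriv.1 hh).2 (fun i hi => ?_) ?_
      · rw [← iteratedDeriv_succ']
        exact hzero _ (by omega)
      · rwa [← iteratedDeriv_succ']
    have h0 : h 0 = 0 := by simpa using hzero 0 m.succ_pos
    obtain ⟨u, hu, hsub⟩ := mem_nhdsGT_iff_exists_Ioo_subset.1 hderiv
    have hmono : StrictMonoOn h (Ico 0 u) :=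
      strictMonoOn_of_deriv_pos (convex_Ico 0 u) hh.continuous.continuousOn
        (by rw [interior_Ico]; exact fun x hx => hsub hx)
    filter_upwards [Ioo_mem_nhdsGT hu] with x hx
    rw [← h0]
    exact hmono ⟨le_rfl, hu⟩ ⟨hx.1.le, hx.2⟩ hx.1

theorem exists_contDiff_iteratedDeriv_zero_eq_of_pos (c : ℕ → ℝ)
    (hc : (∀ j, c j = 0) ∨ ∃ j, (∀ i < j, c i = 0) ∧ 0 < c j) :
    ∃ h : ℝ → ℝ, ContDiff ℝ (⊤ : ℕ∞) h ∧ (∀ n, iteratedDeriv n h 0 = c n) ∧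
      ∀ᶠ x in 𝓝[>] 0, 0 < h x := by
  rcases hc with hc | ⟨j, hj, hpos⟩
  · refine ⟨expNegInvGlue, expNegInvGlue.contDiff, fun n => ?_, ?_⟩
    · rw [iteratedDeriv_expNegInvGlue_zero, hc]
    · filter_upwards [self_mem_nhdsWithin] with x hx
      exact expNegInvGlue.pos_of_pos hx
  · obtain ⟨h, hh, hder⟩ := exists_contDiff_iteratedDeriv_zero_eq_s14 c
    refine ⟨h, hh, hder, eventually_pos_of_iteratedDeriv_pos j hh (fun i hi => ?_) ?_⟩
    · rw [hder, hj i hi]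
    · rwa [hder]

/-- Smooth functions positive to the right of `a` and to the left of `b` can be glued to a smooth
function positive on `(a, b)`, keeping their germs at `a` and `b`. -/
theorem exists_contDiff_pos_eventuallyEq {a b : ℝ} (hab : a < b) {p q : ℝ → ℝ}
    (hp : ContDiff ℝ (⊤ : ℕ∞) p) (hq : ContDiff ℝ (⊤ : ℕ∞) q)
    (hpa : ∀ᶠ x in 𝓝[>] a, 0 < p x) (hqb : ∀ᶠ x in 𝓝[<] b, 0 < q x) :
    ∃ g : ℝ → ℝ, ContDiff ℝ (⊤ : ℕ∞) g ∧ (∀ x ∈ Ioo a b, 0 < g x) ∧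
      g =ᶠ[𝓝 a] p ∧ g =ᶠ[𝓝 b] q := by
  obtain ⟨u, hu, hpu⟩ := mem_nhdsGT_iff_exists_Ioo_subset.1 hpa
  obtain ⟨w, hw, hqw⟩ := mem_nhdsLT_iff_exists_Ioo_subset.1 hqb
  simp only [mem_Ioi, mem_Iio] at hu hw
  obtain ⟨r, hr0, hr⟩ : ∃ r, 0 < r ∧ r < min (min (u - a) (b - w)) ((b - a) / 2) :=
    exists_between (by simp only [lt_min_iff]; refine ⟨⟨?_, ?_⟩, ?_⟩ <;> linarith)
  simp only [lt_min_iff] at hr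
  obtain ⟨⟨hru, hrw⟩, hrab⟩ := hr
  let χ : ∀ c : ℝ, ContDiffBump c := fun c => ⟨r / 2, r, half_pos hr0, half_lt_self hr0⟩
  have hzero : ∀ c x, r ≤ |x - c| → χ c x = 0 := fun c x hx => (χ c).zero_of_le_dist hx
  have hcombo : ∀ s y : ℝ, 0 ≤ s → s ≤ 1 → 0 < y → 0 < s * y + (1 - s) := fun s y h0 h1 hy => by
    rcases h0.eq_or_lt with rfl | h0
    · simp
    · have := mul_pos h0 hy
      linarith
  refine ⟨fun x => χ a x * p x + χ b x * q x + (1 - χ a x - χ b x), ?_, fun x hx => ?_, ?_, ?_⟩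
  · exact (((χ a).contDiff.mul hp).add ((χ b).contDiff.mul hq)).add
      ((contDiff_const.sub (χ a).contDiff).sub (χ b).contDiff)
  · obtain ⟨hax, hxb⟩ := hx
    rcases le_or_gt (x - a) r with hxa | hxa
    · have hb : χ b x = 0 := hzero b x (by rw [abs_sub_comm]; exact le_abs.2 (Or.inl (by linarith)))
      have := hcombo (χ a x) (p x) (χ a).nonneg (χ a).le_one (hpu ⟨hax, by linarith⟩)
      simpa [hb] using this
    · have ha : χ a x = 0 := hzero a x (le_abs.2 (Or.inl hxa.le))
      rcases le_or_gt (b - x) r with hbx | hbx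
      · have := hcombo (χ b x) (q x) (χ b).nonneg (χ b).le_one (hqw ⟨by linarith, hxb⟩)
        simpa [ha] using this
      · have hb : χ b x = 0 := hzero b x (by rw [abs_sub_comm]; exact le_abs.2 (Or.inl hbx.le))
        simp [ha, hb]
  · have hlt : ∀ᶠ x in 𝓝 a, x < b - r := eventually_lt_nhds (by linarith)
    filter_upwards [(χ a).eventuallyEq_one, hlt] with x hx hxb
    have hb : χ b x = 0 := hzero b x (by rw [abs_sub_comm]; exact le_abs.2 (Or.inl (by linarith)))
    simp [hx, hb]
  · have hlt : ∀ᶠ x in 𝓝 b, a + r < x := eventually_gt_nhds (by linarith)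
    filter_upwards [(χ b).eventuallyEq_one, hlt] with x hx hxa
    have ha : χ a x = 0 := hzero a x (le_abs.2 (Or.inl (by linarith)))
    simp [hx, ha]

theorem stmt14 (α β : ℕ → ℝ) (h0 : α 0 < β 0)
    (hα : (∀ j, 1 ≤ j → α j = 0) ∨
      (∃ j, 1 ≤ j ∧ (∀ i, 1 ≤ i → i < j → α i = 0) ∧ 0 < α j))
    (hβ : (∀ j, 1 ≤ j → β j = 0) ∨
      (∃ j, 1 ≤ j ∧ (∀ i, 1 ≤ i → i < j → β i = 0) ∧ 0 < (-1 : ℝ) ^ (j + 1) * β j))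
    (a b : ℝ) (hab : a < b) :
    ∃ f : ℝ → ℝ, ContDiff ℝ (⊤ : ℕ∞) f ∧
      (∀ x ∈ Ioo a b, 0 < deriv f x) ∧
      (∀ j : ℕ, 1 ≤ j → iteratedDeriv j f a = α j ∧ iteratedDeriv j f b = β j) := by
  obtain ⟨p, hp, hpder, hppos⟩ := exists_contDiff_iteratedDeriv_zero_eq_of_pos
    (fun n => α (n + 1)) (by
      rcases hα with hα | ⟨j, hj, hα, hpos⟩
      · exact Or.inl fun j => hα _ (by omega)
      · obtain ⟨k, rfl⟩ := Nat.exists_eq_add_of_le' hj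
        exact Or.inr ⟨k, fun i hi => hα _ (by omega) (by omega), hpos⟩)
  obtain ⟨q, hq, hqder, hqpos⟩ := exists_contDiff_iteratedDeriv_zero_eq_of_pos
    (fun n => (-1) ^ n * β (n + 1)) (by
      rcases hβ with hβ | ⟨j, hj, hβ, hpos⟩
      · exact Or.inl fun j => by rw [hβ _ (by omega), mul_zero]
      · obtain ⟨k, rfl⟩ := Nat.exists_eq_add_of_le' hj
        refine Or.inr ⟨k, fun i hi => by rw [hβ _ (by omega) (by omega), mul_zero], ?_⟩
        rw [pow_succ, pow_succ] at hpos
        linarith)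
  have hshift : Tendsto (fun x => x - a) (𝓝[>] a) (𝓝[>] 0) := by
    refine tendsto_nhdsWithin_iff.2 ⟨?_, ?_⟩
    · exact ((continuous_id.sub continuous_const).tendsto' a 0 (sub_self a)).mono_left
        nhdsWithin_le_nhds
    · filter_upwards [self_mem_nhdsWithin] with x hx
      exact sub_pos.2 (mem_Ioi.1 hx)
  have hreflect : Tendsto (fun x => -(x - b)) (𝓝[<] b) (𝓝[>] 0) := by
    refine tendsto_nhdsWithin_iff.2 ⟨?_, ?_⟩
    · exact ((continuous_id.sub continuous_const).neg.tendsto' b 0 (by simp)).mono_left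
        nhdsWithin_le_nhds
    · filter_upwards [self_mem_nhdsWithin] with x hx
      simpa using hx
  obtain ⟨g, hg, hgpos, hga, hgb⟩ := exists_contDiff_pos_eventuallyEq hab
    (hp.comp (contDiff_id.sub contDiff_const)) (hq.comp (contDiff_id.sub contDiff_const).neg)
    (hshift.eventually hppos) (hreflect.eventually hqpos)
  have hderiv : deriv (fun x => ∫ y in a..x, g y) = g :=
    funext fun x => hg.continuous.deriv_integral g a x
  refine ⟨fun x => ∫ y in a..x, g y, ?_, ?_, ?_⟩
  · refine contDiff_infty_iff_deriv.2 ⟨fun x => ?_, by rwa [hderiv]⟩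
    exact (hg.continuous.integral_hasStrictDerivAt a x).hasDerivAt.differentiableAt
  · rwa [hderiv]
  · intro j hj
    obtain ⟨k, rfl⟩ := Nat.exists_eq_add_of_le' hj
    rw [iteratedDeriv_succ', hderiv]
    constructor
    · rw [hga.iteratedDeriv_eq]
      refine (congrFun (iteratedDeriv_comp_sub_const k p a) a).trans ?_
      rw [sub_self, hpder]
    · rw [hgb.iteratedDeriv_eq]
      refine (congrFun (iteratedDeriv_comp_sub_const k (fun x => q (-x)) b) b).trans ?_
      rw [iteratedDeriv_comp_neg, sub_self, neg_zero, hqder, smul_eq_mul, ← mul_assoc, ← mul_pow]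
      simp
end

section
/- Let m₁, m₂, a, c be real numbers and δ > 0. Let F : ℝ → ℝ be the piecewise linear function F(x) = m₁(x−a) + c for x ≤ a and F(x) = m₂(x−a) + c for x ≥ a. Then there exists a C^∞ function G : ℝ → ℝ such that: (1) if m₁ = m₂ then G = F; (2) if m₁ ≠ m₂ then G(x) = F(x) for all x ∉ (a−δ, a+δ) and the second derivative of G is nonzero at every point of (a−δ, a+δ); (3) for every x ∈ [a−δ, a+δ], the point (x, G(x)) lies in the convex hull in ℝ² of the three points (a−δ, F(a−δ)), (a, c), and (a+δ, F(a+δ)). -/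
open Set

/-- The primitive of a smooth function is smooth. -/
theorem contDiff_infty_intervalIntegral {f : ℝ → ℝ} (hf : ContDiff ℝ (⊤ : ℕ∞) f) (b : ℝ) :
    ContDiff ℝ (⊤ : ℕ∞) (fun x => ∫ t in b..x, f t) := by
  have hd : ∀ x, HasDerivAt (fun x => ∫ t in b..x, f t) (f x) x := fun x =>
    intervalIntegral.integral_hasDerivAt_right (hf.continuous.intervalIntegrable _ _)
      hf.continuous.aestronglyMeasurable.stronglyMeasurableAtFilter hf.continuous.continuousAt
  rw [contDiff_infty_iff_deriv]
  refine ⟨fun x => (hd x).differentiableAt, ?_⟩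
  rwa [show deriv (fun x => ∫ t in b..x, f t) = f from funext fun x => (hd x).deriv]

/-- A smooth even bump function supported on `[-δ, δ]`, positive exactly on `(-δ, δ)`. -/
theorem exists_even_smooth_bump (δ : ℝ) :
    ∃ φ : ℝ → ℝ, ContDiff ℝ (⊤ : ℕ∞) φ ∧ (∀ x, φ (-x) = φ x) ∧ (∀ x, 0 ≤ φ x) ∧
      (∀ x ∈ Ioo (-δ) δ, 0 < φ x) ∧ ∀ x, δ ≤ x → φ x = 0 := by
  refine ⟨fun x => expNegInvGlue (δ - x) * expNegInvGlue (δ + x), ?_, ?_, ?_, ?_, ?_⟩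
  · exact (expNegInvGlue.contDiff.comp (contDiff_const.sub contDiff_id)).mul
      (expNegInvGlue.contDiff.comp (contDiff_const.add contDiff_id))
  · intro x
    simp only [sub_neg_eq_add, ← sub_eq_add_neg]
    ring
  · exact fun x => mul_nonneg (expNegInvGlue.nonneg _) (expNegInvGlue.nonneg _)
  · exact fun x hx => mul_pos (expNegInvGlue.pos_of_pos (by linarith [hx.2]))
      (expNegInvGlue.pos_of_pos (by linarith [hx.1]))
  · intro x hx
    simp [expNegInvGlue.zero_of_nonpos (show δ - x ≤ 0 by linarith)]

/-- A smooth odd monotone function equal to `1` on `[δ, ∞)`, with positive derivative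
on `(-δ, δ)`. -/
theorem exists_smooth_odd_sign {δ : ℝ} (hδ : 0 < δ) :
    ∃ q : ℝ → ℝ, ContDiff ℝ (⊤ : ℕ∞) q ∧ (∀ x, q (-x) = - q x) ∧ Monotone q ∧
      (∀ x ∈ Ioo (-δ) δ, 0 < deriv q x) ∧ ∀ x, δ ≤ x → q x = 1 := by
  obtain ⟨φ, hφ, heven, hnonneg, hpos, hzero⟩ := exists_even_smooth_bump δ
  have hint : ∀ u v, IntervalIntegrable φ MeasureTheory.volume u v := fun u v =>
    hφ.continuous.intervalIntegrable u v
  set I := ∫ t in (0 : ℝ)..δ, φ t with hI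
  have hIpos : 0 < I := intervalIntegral.intervalIntegral_pos_of_pos_on (hint _ _)
    (fun x hx => hpos x ⟨by linarith [hx.1], hx.2⟩) hδ
  have hd : ∀ x, HasDerivAt (fun x => (∫ t in (0 : ℝ)..x, φ t) / I) (φ x / I) x := fun x =>
    (intervalIntegral.integral_hasDerivAt_right (hint _ _)
      hφ.continuous.aestronglyMeasurable.stronglyMeasurableAtFilter
      hφ.continuous.continuousAt).div_const I
  refine ⟨fun x => (∫ t in (0 : ℝ)..x, φ t) / I,
    (contDiff_infty_intervalIntegral hφ 0).div_const I, ?_, ?_, ?_, ?_⟩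
  · intro x
    have h : ∫ t in (0 : ℝ)..x, φ (-t) = ∫ t in (-x)..(-0), φ t :=
      intervalIntegral.integral_comp_neg φ
    simp only [heven, neg_zero] at h
    simp only
    rw [h, intervalIntegral.integral_symm, neg_div]
  · refine monotone_of_deriv_nonneg (fun x => (hd x).differentiableAt) fun x => ?_
    rw [(hd x).deriv]
    exact div_nonneg (hnonneg x) hIpos.le
  · intro x hx
    rw [(hd x).deriv]
    exact div_pos (hpos x hx) hIpos
  · intro x hx
    have h : ∫ t in δ..x, φ t = 0 := by
      rw [intervalIntegral.integral_congr (g := fun _ => (0 : ℝ))]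
      · simp
      · intro t ht
        rw [uIcc_of_le hx] at ht
        exact hzero t ht.1
    have := intervalIntegral.integral_add_adjacent_intervals (hint 0 δ) (hint δ x)
    simp only
    rw [← this, h, add_zero, ← hI, div_self hIpos.ne']

/-- A smoothing of the absolute value which is unchanged outside `(-δ, δ)`, has positive second
derivative on `(-δ, δ)`, and lies between `|x|` and `δ` there. -/
theorem exists_smooth_abs {δ : ℝ} (hδ : 0 < δ) :
    ∃ A : ℝ → ℝ, ContDiff ℝ (⊤ : ℕ∞) A ∧ (∀ x, x ∉ Ioo (-δ) δ → A x = |x|) ∧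
      (∀ x ∈ Ioo (-δ) δ, 0 < iteratedDeriv 2 A x) ∧
      ∀ x ∈ Icc (-δ) δ, |x| ≤ A x ∧ A x ≤ δ := by
  obtain ⟨q, hq, hodd, hmono, hderiv, hone⟩ := exists_smooth_odd_sign hδ
  have hint : ∀ u v, IntervalIntegrable q MeasureTheory.volume u v := fun u v =>
    hq.continuous.intervalIntegrable u v
  have hq0 : q 0 = 0 := by
    have := hodd 0
    rw [neg_zero] at this
    linarith
  set A : ℝ → ℝ := fun x => δ + ∫ t in δ..x, q t with hA
  have hd : ∀ x, HasDerivAt A (q x) x := fun x =>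
    (intervalIntegral.integral_hasDerivAt_right (hint _ _)
      hq.continuous.aestronglyMeasurable.stronglyMeasurableAtFilter
      hq.continuous.continuousAt).const_add δ
  have heven : ∀ x, A (-x) = A x := by
    intro x
    have h : ∫ t in (-x)..x, q (-t) = ∫ t in (-x)..(-(-x)), q t :=
      intervalIntegral.integral_comp_neg q
    simp only [hodd, neg_neg, intervalIntegral.integral_neg] at h
    have := intervalIntegral.integral_add_adjacent_intervals (hint δ (-x)) (hint (-x) x)
    simp only [hA]
    linarith
  have hout : ∀ x, δ ≤ x → A x = x := by
    intro x hx
    have h : ∫ t in δ..x, q t = x - δ := by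
      rw [intervalIntegral.integral_congr (g := fun _ => (1 : ℝ))]
      · simp
      · intro t ht
        rw [uIcc_of_le hx] at ht
        exact hone t ht.1
    simp only [hA, h]
    ring
  have hin : ∀ x, 0 ≤ x → x ≤ δ → x ≤ A x ∧ A x ≤ δ := by
    intro x hx hxδ
    have hlow : 0 ≤ ∫ t in x..δ, q t := intervalIntegral.integral_nonneg hxδ fun t ht =>
      hq0 ▸ hmono (hx.trans ht.1)
    have hup : ∫ t in x..δ, q t ≤ ∫ _ in x..δ, (1 : ℝ) :=
      intervalIntegral.integral_mono_on hxδ (hint _ _) intervalIntegrable_const fun t ht =>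
        (hmono ht.2).trans_eq (hone δ le_rfl)
    rw [intervalIntegral.integral_const, smul_eq_mul, mul_one] at hup
    have := intervalIntegral.integral_symm (f := q) (μ := MeasureTheory.volume) x δ
    simp only [hA]
    constructor <;> linarith
  have habs : ∀ x, A |x| = A x := fun x => by
    rcases abs_choice x with h | h <;> rw [h]
    exact heven x
  refine ⟨A, contDiff_const.add (contDiff_infty_intervalIntegral hq δ), ?_, ?_, ?_⟩
  · intro x hx
    rw [← habs, hout]
    rw [mem_Ioo, ← abs_lt] at hx
    exact not_lt.mp hx
  · intro x hx
    rw [iteratedDeriv_succ, iteratedDeriv_one, show deriv A = q from funext fun x => (hd x).deriv]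
    exact hderiv x hx
  · intro x hx
    rw [← habs]
    exact hin _ (abs_nonneg x) (abs_le.mpr hx)

theorem stmt15 (m₁ m₂ a c δ : ℝ) (hδ : 0 < δ) (F : ℝ → ℝ)
    (hF1 : ∀ x ≤ a, F x = m₁ * (x - a) + c)
    (hF2 : ∀ x, a ≤ x → F x = m₂ * (x - a) + c) :
    ∃ G : ℝ → ℝ, ContDiff ℝ (⊤ : ℕ∞) G ∧
      (m₁ = m₂ → G = F) ∧
      (m₁ ≠ m₂ →
        (∀ x, x ∉ Ioo (a - δ) (a + δ) → G x = F x) ∧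
        (∀ x ∈ Ioo (a - δ) (a + δ), iteratedDeriv 2 G x ≠ 0)) ∧
      (∀ x ∈ Icc (a - δ) (a + δ),
        ((x, G x) : ℝ × ℝ) ∈
          convexHull ℝ ({(a - δ, F (a - δ)), (a, c), (a + δ, F (a + δ))} : Set (ℝ × ℝ))) := by
  obtain ⟨A, hA, hout, hpos, hin⟩ := exists_smooth_abs hδ
  have hF : ∀ x, F x = c + (m₁ + m₂) / 2 * (x - a) + (m₂ - m₁) / 2 * |x - a| := by
    intro x
    rcases le_total x a with h | h
    · rw [hF1 x h, abs_of_nonpos (by linarith)]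
      ring
    · rw [hF2 x h, abs_of_nonneg (by linarith)]
      ring
  refine ⟨fun x => c + (m₁ + m₂) / 2 * (x - a) + (m₂ - m₁) / 2 * A (x - a), ?_, ?_, ?_, ?_⟩
  · have : ContDiff ℝ (⊤ : ℕ∞) fun x => A (x - a) := hA.comp (contDiff_id.sub contDiff_const)
    fun_prop
  · rintro rfl
    funext x
    rw [hF x]
    ring
  · intro hne
    refine ⟨fun x hx => ?_, fun x hx => ?_⟩
    · simp only
      rw [hF x, hout]
      exact fun h => hx ⟨by linarith [h.1], by linarith [h.2]⟩
    · have hA1 : ∀ x, HasDerivAt A (deriv A x) x := fun x =>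
        (hA.differentiable (by simp) x).hasDerivAt
      have hA2 : ∀ x, HasDerivAt (deriv A) (deriv (deriv A) x) x := fun x =>
        ((contDiff_infty_iff_deriv.mp hA).2.differentiable (by simp) x).hasDerivAt
      have h1 : deriv (fun x => c + (m₁ + m₂) / 2 * (x - a) + (m₂ - m₁) / 2 * A (x - a)) =
          fun x => (m₁ + m₂) / 2 + (m₂ - m₁) / 2 * deriv A (x - a) := by
        funext y
        have hl := (((hasDerivAt_id y).sub_const a).const_mul ((m₁ + m₂) / 2)).const_add c
        have hr := ((hA1 (y - a)).comp_sub_const y a).const_mul ((m₂ - m₁) / 2)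
        simpa using (hl.fun_add hr).deriv
      have h2 : HasDerivAt (fun x => (m₁ + m₂) / 2 + (m₂ - m₁) / 2 * deriv A (x - a))
          ((m₂ - m₁) / 2 * deriv (deriv A) (x - a)) x :=
        (((hA2 (x - a)).comp_sub_const x a).const_mul ((m₂ - m₁) / 2)).const_add _
      have hx' := hpos (x - a) ⟨by linarith [hx.1], by linarith [hx.2]⟩
      rw [iteratedDeriv_succ, iteratedDeriv_one] at hx' ⊢
      rw [h1, h2.deriv]
      exact mul_ne_zero (div_ne_zero (sub_ne_zero.mpr hne.symm) two_ne_zero) hx'.ne'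
  · intro x hx
    obtain ⟨hl, hu⟩ := hin (x - a) ⟨by linarith [hx.1], by linarith [hx.2]⟩
    obtain ⟨hl1, hl2⟩ := abs_le.mp hl
    rw [hF1 (a - δ) (by linarith), hF2 (a + δ) (by linarith)]
    set y := A (x - a)
    set S : Set (ℝ × ℝ) :=
      {(a - δ, m₁ * (a - δ - a) + c), (a, c), (a + δ, m₂ * (a + δ - a) + c)} with hS
    have key := (convex_convexHull ℝ S).sum_mem (t := Finset.univ)
      (w := ![(y - (x - a)) / (2 * δ), (δ - y) / δ, (y + (x - a)) / (2 * δ)])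
      (z := ![(a - δ, m₁ * (a - δ - a) + c), (a, c), (a + δ, m₂ * (a + δ - a) + c)])
      (by
        intro i _
        fin_cases i
        · exact div_nonneg (by linarith) (by linarith)
        · exact div_nonneg (by linarith) hδ.le
        · exact div_nonneg (by linarith) (by linarith))
      (by
        simp only [Fin.sum_univ_three, Matrix.cons_val]
        field_simp
        ring)
      (by
        intro i _
        apply subset_convexHull ℝ S
        fin_cases i <;> simp [hS])
    convert key using 1
    simp only [Fin.sum_univ_three, Matrix.cons_val, Prod.smul_mk, Prod.mk_add_mk, smul_eq_mul]
    ext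
    · simp only
      field_simp
      ring
    · simp only
      field_simp
      ring
end

section
/- Let f : [0,1] → [0,1] be increasing, with a = I(f)(1) and b = I²(f)(1). Then: (1) for all x ∈ [0,1], max(x−(1−a), 0) ≤ I(f)(x) ≤ ax; (2) for all x ∈ [0,1], (max(x−(1−a), 0))²/2 ≤ I²(f)(x) ≤ ax²/2; (3) a²/2 ≤ b ≤ a/2, where the first inequality is strict unless f = 0 on (0, 1−a) and f = 1 on (1−a, 1), and the second inequality is strict unless f is constant on (0,1). -/
open Set

lemma intervalIntegrable_of_monotoneOn_Icc {f : ℝ → ℝ} (hmono : MonotoneOn f (Icc 0 1)) {x y : ℝ}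
    (hx : x ∈ Icc (0:ℝ) 1) (hy : y ∈ Icc (0:ℝ) 1) :
    IntervalIntegrable f MeasureTheory.volume x y :=
  (hmono.mono (uIcc_subset_Icc hx hy)).intervalIntegrable

lemma I_sub_I {f : ℝ → ℝ} (hmono : MonotoneOn f (Icc 0 1)) {x y : ℝ}
    (hx : x ∈ Icc (0:ℝ) 1) (hy : y ∈ Icc (0:ℝ) 1) :
    I f y - I f x = ∫ t in x..y, f t :=
  intervalIntegral.integral_interval_sub_left
    (intervalIntegrable_of_monotoneOn_Icc hmono (by simp) hy)
    (intervalIntegrable_of_monotoneOn_Icc hmono (by simp) hx)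

lemma mul_le_I_sub_I {f : ℝ → ℝ} (hmono : MonotoneOn f (Icc 0 1)) {x y : ℝ}
    (hx : x ∈ Icc (0:ℝ) 1) (hy : y ∈ Icc (0:ℝ) 1) (hxy : x ≤ y) :
    f x * (y - x) ≤ I f y - I f x := by
  have h := intervalIntegral.integral_mono_on (f := fun _ => f x) (g := f) hxy
    intervalIntegrable_const (intervalIntegrable_of_monotoneOn_Icc hmono hx hy)
    (fun t ht => hmono hx ⟨hx.1.trans ht.1, ht.2.trans hy.2⟩ ht.1)
  rw [I_sub_I hmono hx hy]
  simpa [mul_comm] using h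

lemma I_sub_I_le_mul {f : ℝ → ℝ} (hmono : MonotoneOn f (Icc 0 1)) {x y : ℝ}
    (hx : x ∈ Icc (0:ℝ) 1) (hy : y ∈ Icc (0:ℝ) 1) (hxy : x ≤ y) :
    I f y - I f x ≤ f y * (y - x) := by
  have h := intervalIntegral.integral_mono_on (f := f) (g := fun _ => f y) hxy
    (intervalIntegrable_of_monotoneOn_Icc hmono hx hy) intervalIntegrable_const
    (fun t ht => hmono ⟨hx.1.trans ht.1, ht.2.trans hy.2⟩ hy ht.2)
  rw [I_sub_I hmono hx hy]
  simpa [mul_comm] using h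

lemma continuousOn_I {f : ℝ → ℝ} (hmono : MonotoneOn f (Icc 0 1)) :
    ContinuousOn (I f) (Icc 0 1) := by
  have h := intervalIntegral.continuousOn_primitive_interval (a := (0:ℝ)) (b := 1) (f := f)
    (μ := MeasureTheory.volume)
    (by
      rw [uIcc_of_le zero_le_one]
      exact hmono.integrableOn_isCompact isCompact_Icc)
  rwa [uIcc_of_le zero_le_one] at h

lemma integral_max_sub_zero {c x : ℝ} (hc : 0 ≤ c) (hx : 0 ≤ x) :
    ∫ t in (0:ℝ)..x, max (t - c) 0 = (max (x - c) 0) ^ 2 / 2 := by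
  have hzero : ∀ y : ℝ, 0 ≤ y → y ≤ c → ∫ t in (0:ℝ)..y, max (t - c) 0 = 0 := by
    intro y hy hyc
    rw [intervalIntegral.integral_congr (g := fun _ => (0:ℝ))]
    · simp
    · intro t ht
      rw [uIcc_of_le hy] at ht
      exact max_eq_right (by linarith [ht.2])
  have hint : ∀ u v : ℝ, IntervalIntegrable (fun t : ℝ => max (t - c) 0)
      MeasureTheory.volume u v := fun u v =>
    Continuous.intervalIntegrable (by fun_prop) u v
  rcases le_total x c with h | h
  · rw [hzero x hx h, max_eq_right (by linarith)]
    simp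
  · rw [← intervalIntegral.integral_add_adjacent_intervals (hint 0 c) (hint c x),
      hzero c hc le_rfl, max_eq_left (by linarith : 0 ≤ x - c),
      intervalIntegral.integral_congr (g := fun t => t - c)]
    · rw [intervalIntegral.integral_sub (by simp) (by simp)]
      simp
      ring
    · intro t ht
      rw [uIcc_of_le h] at ht
      exact max_eq_left (by linarith [ht.1])

lemma eqOn_of_le_of_integral_eq {g h : ℝ → ℝ} (hg : ContinuousOn g (Icc 0 1))
    (hh : ContinuousOn h (Icc 0 1)) (hle : ∀ x ∈ Icc (0:ℝ) 1, g x ≤ h x)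
    (heq : ∫ t in (0:ℝ)..1, g t = ∫ t in (0:ℝ)..1, h t) :
    ∀ x ∈ Icc (0:ℝ) 1, g x = h x := by
  intro x hx
  by_contra hne
  exact (intervalIntegral.integral_lt_integral_of_continuousOn_of_le_of_exists_lt
    zero_lt_one hg hh (fun t ht => hle t (Ioc_subset_Icc_self ht))
    ⟨x, hx, lt_of_le_of_ne (hle x hx) hne⟩).ne heq

theorem stmt17 (f : ℝ → ℝ)
    (hmono : MonotoneOn f (Icc 0 1))
    (hmap : ∀ x ∈ Icc (0:ℝ) 1, f x ∈ Icc (0:ℝ) 1)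
    (a b : ℝ) (ha : a = I f 1) (hb : b = I (I f) 1) :
    (∀ x ∈ Icc (0:ℝ) 1, max (x - (1 - a)) 0 ≤ I f x ∧ I f x ≤ a * x) ∧
    (∀ x ∈ Icc (0:ℝ) 1,
      (max (x - (1 - a)) 0) ^ 2 / 2 ≤ I (I f) x ∧ I (I f) x ≤ a * x ^ 2 / 2) ∧
    (a ^ 2 / 2 ≤ b ∧ b ≤ a / 2) ∧
    (b = a ^ 2 / 2 →
      (∀ x ∈ Ioo (0:ℝ) (1 - a), f x = 0) ∧ (∀ x ∈ Ioo (1 - a) (1:ℝ), f x = 1)) ∧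
    (b = a / 2 → ∃ k : ℝ, ∀ x ∈ Ioo (0:ℝ) 1, f x = k) := by
  have h0 : (0:ℝ) ∈ Icc (0:ℝ) 1 := by simp
  have h1 : (1:ℝ) ∈ Icc (0:ℝ) 1 := by simp
  have hI0 : I f 0 = 0 := by simp [I]
  have hbound : ∀ x ∈ Icc (0:ℝ) 1, max (x - (1 - a)) 0 ≤ I f x ∧ I f x ≤ a * x := by
    intro x hx
    have l0 := mul_le_I_sub_I hmono h0 hx hx.1
    have u0 := I_sub_I_le_mul hmono h0 hx hx.1
    have l1 := mul_le_I_sub_I hmono hx h1 hx.2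
    have u1 := I_sub_I_le_mul hmono hx h1 hx.2
    rw [← ha] at l1 u1
    rw [hI0] at l0 u0
    obtain ⟨hx0, hx1⟩ := hx
    refine ⟨max_le ?_ ?_, ?_⟩
    · nlinarith [(hmap 1 h1).2]
    · nlinarith [(hmap 0 h0).1]
    · nlinarith
  have ha0 : 0 ≤ a := by
    rw [ha]
    exact (le_max_right _ _).trans (hbound 1 h1).1
  have ha1 : a ≤ 1 := by
    have := (le_max_left _ _).trans (hbound 0 h0).1
    linarith
  have hcont := continuousOn_I hmono
  have hcmax : Continuous fun t : ℝ => max (t - (1 - a)) 0 := by fun_prop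
  have hclin : Continuous fun t : ℝ => a * t := by fun_prop
  have hlin : ∀ x : ℝ, ∫ t in (0:ℝ)..x, a * t = a * x ^ 2 / 2 := by
    intro x
    rw [intervalIntegral.integral_const_mul, integral_id]
    ring
  have hbound₂ : ∀ x ∈ Icc (0:ℝ) 1,
      (max (x - (1 - a)) 0) ^ 2 / 2 ≤ I (I f) x ∧ I (I f) x ≤ a * x ^ 2 / 2 := by
    intro x hx
    have hFint : IntervalIntegrable (I f) MeasureTheory.volume 0 x :=
      (hcont.mono (uIcc_subset_Icc h0 hx)).intervalIntegrable
    rw [← integral_max_sub_zero (by linarith) hx.1, ← hlin]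
    exact ⟨intervalIntegral.integral_mono_on hx.1 (hcmax.intervalIntegrable 0 x) hFint
        fun t ht => (hbound t ⟨ht.1, ht.2.trans hx.2⟩).1,
      intervalIntegral.integral_mono_on hx.1 hFint (hclin.intervalIntegrable 0 x)
        fun t ht => (hbound t ⟨ht.1, ht.2.trans hx.2⟩).2⟩
  have hmax1 : max (1 - (1 - a)) 0 = a := by
    rw [sub_sub_cancel, max_eq_left ha0]
  refine ⟨hbound, hbound₂, ?_, ?_, ?_⟩
  · have h := hbound₂ 1 h1
    rw [hmax1, ← hb] at h
    simpa using h
  · intro hba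
    have hF := eqOn_of_le_of_integral_eq hcmax.continuousOn hcont (fun x hx => (hbound x hx).1)
      (by
        rw [integral_max_sub_zero (by linarith) zero_le_one, hmax1, ← hba, hb]
        rfl)
    have hc : 1 - a ∈ Icc (0:ℝ) 1 := ⟨by linarith, by linarith⟩
    have hFc : I f (1 - a) = 0 := by simp [← hF _ hc]
    constructor
    · rintro x ⟨hx0, hx1⟩
      have hx : x ∈ Icc (0:ℝ) 1 := ⟨hx0.le, by linarith⟩
      have h := mul_le_I_sub_I hmono hx hc hx1.le
      rw [hFc, ← hF x hx, max_eq_right (by linarith)] at h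
      have := (hmap x hx).1
      nlinarith
    · rintro x ⟨hx0, hx1⟩
      have hx : x ∈ Icc (0:ℝ) 1 := ⟨by linarith, hx1.le⟩
      have h := I_sub_I_le_mul hmono hc hx hx0.le
      rw [hFc, ← hF x hx, max_eq_left (by linarith)] at h
      have := (hmap x hx).2
      nlinarith
  · intro hba
    have hF := eqOn_of_le_of_integral_eq hcont hclin.continuousOn (fun x hx => (hbound x hx).2)
      (by
        rw [hlin, one_pow, mul_one, ← hba, hb]
        rfl)
    refine ⟨a, fun x hx => ?_⟩
    have hx' := Ioo_subset_Icc_self hx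
    have hu := I_sub_I_le_mul hmono h0 hx' hx.1.le
    have hl := mul_le_I_sub_I hmono hx' h1 hx.2.le
    rw [hI0, hF x hx'] at hu
    rw [hF x hx', hF 1 h1] at hl
    obtain ⟨hx0, hx1⟩ := hx
    apply le_antisymm
    · nlinarith
    · nlinarith
end

section
/- Let f : [0,1] → [0,1] be increasing, with a = I(f)(1), b = I²(f)(1), c = I³(f)(1). Assume a²/2 < b < a/2 (which forces 0 < a < 1). Then 2b²/(3a) ≤ c ≤ (−a² + 2ab − 4b² + 2b)/(6(1−a)). -/
open Set

open MeasureTheory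

/-- A monotone function on an interval crosses a given level at some point of the interval. -/
lemma MonotoneOn.exists_crossing {f : ℝ → ℝ} {u v : ℝ} (huv : u ≤ v)
    (hf : MonotoneOn f (Icc u v)) (k : ℝ) :
    ∃ p ∈ Icc u v, ∀ t ∈ Icc u v, (t < p → f t ≤ k) ∧ (p < t → k ≤ f t) := by
  let S : Set ℝ := {t ∈ Icc u v | f t < k} ∪ {u}
  have hne : S.Nonempty := ⟨u, Or.inr rfl⟩
  have hle : ∀ t ∈ S, t ≤ v := by
    rintro t (ht | rfl)
    exacts [ht.1.2, huv]
  have hbdd : BddAbove S := ⟨v, hle⟩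
  refine ⟨sSup S, ⟨le_csSup hbdd (Or.inr rfl), csSup_le hne hle⟩,
    fun t ht => ⟨fun h => ?_, fun h => ?_⟩⟩
  · obtain ⟨s, hs, hts⟩ := exists_lt_of_lt_csSup hne h
    rcases hs with hs | rfl
    · exact (hf ht hs.1 hts.le).trans hs.2.le
    · exact absurd ht.1 (not_le.mpr hts)
  · by_contra! hk
    exact absurd (le_csSup hbdd (Or.inl ⟨ht, hk⟩)) (not_le.mpr h)

/-- A sharp moment inequality for nonnegative increasing functions on `[0, 1]`. -/
lemma four_mul_sq_moment_le {f : ℝ → ℝ} (hf : MonotoneOn f (Icc 0 1))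
    (hf0 : ∀ x ∈ Icc (0 : ℝ) 1, 0 ≤ f x) {A B C : ℝ}
    (hA : A = ∫ t in (0 : ℝ)..1, f t) (hB : B = ∫ t in (0 : ℝ)..1, (1 - t) * f t)
    (hC : C = ∫ t in (0 : ℝ)..1, (1 - t) ^ 2 * f t) (hB0 : 0 < B) (hBA : 2 * B ≤ A) :
    4 * B ^ 2 ≤ 3 * A * C := by
  have hA0 : 0 < A := by linarith
  obtain ⟨m, hm⟩ : ∃ m, m = 2 * B / A := ⟨_, rfl⟩
  have hm0 : 0 < m := by rw [hm]; positivity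
  have hm1 : m ≤ 1 := by rw [hm, div_le_one hA0]; exact hBA
  have hmA : m * A = 2 * B := by rw [hm]; field_simp
  obtain ⟨k, hk⟩ : ∃ k, k = A / m := ⟨_, rfl⟩
  have hkm : k * m = A := by rw [hk]; field_simp
  have hint : ∀ x ∈ Icc (0 : ℝ) 1, ∀ y ∈ Icc (0 : ℝ) 1, ∀ g : ℝ → ℝ, Continuous g →
      IntervalIntegrable (fun t => g t * f t) volume x y := fun x hx y hy g hg =>
    (hf.mono (ordConnected_Icc.uIcc_subset hx hy)).intervalIntegrable.continuousOn_mul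
      hg.continuousOn
  have h0 : (0 : ℝ) ∈ Icc (0 : ℝ) 1 := by simp
  have h1 : (1 : ℝ) ∈ Icc (0 : ℝ) 1 := by simp
  have hτ : 1 - m ∈ Icc (0 : ℝ) 1 := ⟨by linarith, by linarith⟩
  obtain ⟨p, hp, hcross⟩ := (hf.mono (Icc_subset_Icc_left hτ.1)).exists_crossing hτ.2 k
  have hleft : 0 ≤ ∫ t in (0 : ℝ)..(1 - m), (t - (1 - m)) * (t - p) * f t := by
    refine intervalIntegral.integral_nonneg hτ.1 fun t ht =>
      mul_nonneg ?_ (hf0 t ⟨ht.1, ht.2.trans hτ.2⟩)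
    exact mul_nonneg_of_nonpos_of_nonpos (by linarith [ht.2]) (by linarith [ht.2, hp.1])
  have hright : 0 ≤ ∫ t in (1 - m)..1, (t - (1 - m)) * (t - p) * (f t - k) := by
    refine intervalIntegral.integral_nonneg hτ.2 fun t ht => ?_
    rw [mul_assoc]
    refine mul_nonneg (by linarith [ht.1]) ?_
    rcases lt_trichotomy t p with h | h | h
    · exact mul_nonneg_of_nonpos_of_nonpos (by linarith) (by linarith [(hcross t ht).1 h])
    · simp [h]
    · exact mul_nonneg (by linarith) (by linarith [(hcross t ht).2 h])
  have hw : Continuous fun t : ℝ => (t - (1 - m)) * (t - p) := by fun_prop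
  have hwk : Continuous fun t : ℝ => (t - (1 - m)) * (t - p) * k := by fun_prop
  have hsplit : ∫ t in (1 - m)..1, (t - (1 - m)) * (t - p) * (f t - k) =
      (∫ t in (1 - m)..1, (t - (1 - m)) * (t - p) * f t) -
        ∫ t in (1 - m)..1, (t - (1 - m)) * (t - p) * k := by
    rw [← intervalIntegral.integral_sub (hint _ hτ _ h1 _ hw) (hwk.intervalIntegrable _ _)]
    simp only [mul_sub]
  have hconst : ∫ t in (1 - m)..1, (t - (1 - m)) * (t - p) * k =
      k * (m ^ 3 / 3 - (m + (1 - p)) * m ^ 2 / 2 + m * (1 - p) * m) := by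
    have hderiv : ∀ t ∈ uIcc (1 - m) 1, HasDerivAt
        (fun t => k * (t ^ 3 / 3 - ((1 - m) + p) * (t ^ 2 / 2) + (1 - m) * p * t))
        ((t - (1 - m)) * (t - p) * k) t := by
      intro t _
      have := (((((hasDerivAt_id t).pow 3).div_const 3).sub
        ((((hasDerivAt_id t).pow 2).div_const 2).const_mul ((1 - m) + p))).add
        ((hasDerivAt_id t).const_mul ((1 - m) * p))).const_mul k
      convert! this using 1
      simp
      ring
    rw [intervalIntegral.integral_eq_sub_of_hasDerivAt hderiv (hwk.intervalIntegrable _ _)]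
    ring
  have hadd := intervalIntegral.integral_add_adjacent_intervals (hint _ h0 _ hτ _ hw)
    (hint _ hτ _ h1 _ hw)
  have hmoment : ∫ t in (0 : ℝ)..1, (t - (1 - m)) * (t - p) * f t =
      C - (m + (1 - p)) * B + m * (1 - p) * A := by
    have e0 := hint 0 h0 1 h1 (fun _ => m * (1 - p)) (by fun_prop)
    have e1 := (hint 0 h0 1 h1 (fun t => 1 - t) (by fun_prop)).const_mul (m + (1 - p))
    have e2 := hint 0 h0 1 h1 (fun t => (1 - t) ^ 2) (by fun_prop)
    rw [hA, hB, hC, ← intervalIntegral.integral_const_mul, ← intervalIntegral.integral_const_mul,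
      ← intervalIntegral.integral_sub e2 e1, ← intervalIntegral.integral_add (e2.sub e1) e0]
    refine intervalIntegral.integral_congr fun t _ => ?_
    ring
  have hC' : 2 * B * m / 3 ≤ C := by
    have hkm2 : k * m ^ 2 = 2 * B := by linear_combination m * hkm + hmA
    have key : C - 2 * B * m / 3 = C - (m + (1 - p)) * B + m * (1 - p) * A -
        k * (m ^ 3 / 3 - (m + (1 - p)) * m ^ 2 / 2 + m * (1 - p) * m) := by
      linear_combination (m / 3 - (m + (1 - p)) / 2 + (1 - p)) * hkm2 - (1 - p) * hmA
    linarith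
  nlinarith [mul_le_mul_of_nonneg_left hC' hA0.le]

/-- Integration by parts against a power of `1 - t`. -/
lemma integral_pow_mul_I {f : ℝ → ℝ} (hf : IntervalIntegrable f volume 0 1) (n : ℕ) :
    ∫ t in (0 : ℝ)..1, (1 - t) ^ n * I f t =
      (∫ t in (0 : ℝ)..1, (1 - t) ^ (n + 1) * f t) / (n + 1) := by
  have hn : (n + 1 : ℝ) ≠ 0 := by positivity
  have hF := hf.absolutelyContinuousOnInterval_intervalIntegral (c := 0) (by simp)
  have hderiv (t : ℝ) : HasDerivAt (fun t : ℝ => -(1 - t) ^ (n + 1) / (n + 1)) ((1 - t) ^ n) t := by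
    have := ((((hasDerivAt_id t).const_sub 1).pow (n + 1)).neg.div_const (n + 1 : ℝ))
    convert! this using 1
    simp
    field_simp
  have hG : AbsolutelyContinuousOnInterval (fun t : ℝ => -(1 - t) ^ (n + 1) / (n + 1)) 0 1 :=
    ContDiffOn.absolutelyContinuousOnInterval (by fun_prop)
  have h := hF.integral_mul_deriv_eq_deriv_mul hG
  have hcongr : ∫ t in (0 : ℝ)..1, deriv (fun x => ∫ s in (0 : ℝ)..x, f s) t *
      (-(1 - t) ^ (n + 1) / (n + 1)) =
      ∫ t in (0 : ℝ)..1, (-1 / (n + 1 : ℝ)) * ((1 - t) ^ (n + 1) * f t) := by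
    refine intervalIntegral.integral_congr_ae ?_
    filter_upwards [hf.ae_hasDerivAt_integral] with t ht hmem
    rw [(ht (uIoc_subset_uIcc hmem) 0 (by simp)).deriv]
    ring
  rw [hcongr, intervalIntegral.integral_const_mul] at h
  simp only [fun t => (hderiv t).deriv] at h
  simp only [I, mul_comm ((1 - _ : ℝ) ^ n)]
  rw [h]
  simp
  ring

theorem stmt18 (f : ℝ → ℝ)
    (hmono : MonotoneOn f (Icc 0 1))
    (hmap : ∀ x ∈ Icc (0:ℝ) 1, f x ∈ Icc (0:ℝ) 1)
    (a b c : ℝ) (ha : a = I f 1) (hb : b = I (I f) 1) (hc : c = I (I (I f)) 1)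
    (h1 : a ^ 2 / 2 < b) (h2 : b < a / 2) :
    2 * b ^ 2 / (3 * a) ≤ c ∧
    c ≤ (-a ^ 2 + 2 * a * b - 4 * b ^ 2 + 2 * b) / (6 * (1 - a)) := by
  have hf : IntervalIntegrable f volume 0 1 :=
    (hmono.mono (uIcc_of_le zero_le_one).subset).intervalIntegrable
  have hF : IntervalIntegrable (I f) volume 0 1 :=
    (intervalIntegral.continuousOn_primitive_interval' hf (by simp)).intervalIntegrable
  have ha' : a = ∫ t in (0 : ℝ)..1, f t := ha
  have hb' : b = ∫ t in (0 : ℝ)..1, (1 - t) * f t := by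
    have := integral_pow_mul_I hf 0
    norm_num at this
    rw [hb, ← this, I]
  have hc' : 2 * c = ∫ t in (0 : ℝ)..1, (1 - t) ^ 2 * f t := by
    have e0 := integral_pow_mul_I hF 0
    have e1 := integral_pow_mul_I hf 1
    norm_num at e0 e1
    have : c = ∫ t in (0 : ℝ)..1, I (I f) t := hc
    linarith
  have ha0 : 0 < a := by nlinarith [sq_nonneg a]
  have ha1 : 0 < 1 - a := by nlinarith
  have hlower := four_mul_sq_moment_le hmono (fun x hx => (hmap x hx).1) ha' hb' hc'
    (by nlinarith [sq_nonneg a]) (by linarith)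
  have hrefl : ∀ x ∈ Icc (0 : ℝ) 1, 1 - x ∈ Icc (0 : ℝ) 1 :=
    fun x hx => ⟨by linarith [hx.2], by linarith [hx.1]⟩
  have hmono' : MonotoneOn (fun t => 1 - f (1 - t)) (Icc 0 1) := fun x hx y hy hxy =>
    sub_le_sub_left (hmono (hrefl y hy) (hrefl x hx) (by linarith)) 1
  have hw {w : ℝ → ℝ} (h : Continuous w) : IntervalIntegrable (fun t => w t * f t) volume 0 1 :=
    hf.continuousOn_mul h.continuousOn
  have i1 := hw (w := fun t => 1 - t) (by fun_prop)
  have i2 := hw (w := fun t => (1 - t) ^ 2) (by fun_prop)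
  have ic {w : ℝ → ℝ} (h : Continuous w) : IntervalIntegrable w volume 0 1 :=
    h.intervalIntegrable 0 1
  have hA : 1 - a = ∫ t in (0 : ℝ)..1, 1 - f (1 - t) := by
    rw [intervalIntegral.integral_comp_sub_left (fun t => 1 - f t)]
    norm_num
    rw [intervalIntegral.integral_sub (by simp) hf, ha']
    simp
  have hB : 1 / 2 - a + b = ∫ t in (0 : ℝ)..1, (1 - t) * (1 - f (1 - t)) := by
    rw [intervalIntegral.integral_comp_sub_left (fun t => t * (1 - f t))]
    have : ∀ t, t * (1 - f t) = t - f t + (1 - t) * f t := fun t => by ring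
    norm_num [this]
    rw [intervalIntegral.integral_add ((ic continuous_id').sub hf) i1,
      intervalIntegral.integral_sub (ic continuous_id') hf, ha', hb']
    norm_num
  have hC : 1 / 3 - a + 2 * b - 2 * c =
      ∫ t in (0 : ℝ)..1, (1 - t) ^ 2 * (1 - f (1 - t)) := by
    rw [intervalIntegral.integral_comp_sub_left (fun t => t ^ 2 * (1 - f t))]
    have : ∀ t, t ^ 2 * (1 - f t) = t ^ 2 - f t + 2 * ((1 - t) * f t) - (1 - t) ^ 2 * f t :=
      fun t => by ring
    simp only [this, sub_zero, sub_self]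
    have is : IntervalIntegrable (fun t : ℝ => t ^ 2) volume 0 1 := ic (by fun_prop)
    rw [intervalIntegral.integral_sub ((is.sub hf).add (i1.const_mul 2)) i2,
      intervalIntegral.integral_add (is.sub hf) (i1.const_mul 2),
      intervalIntegral.integral_sub is hf, intervalIntegral.integral_const_mul, ← ha', ← hb', ← hc']
    norm_num
  have hupper := four_mul_sq_moment_le hmono'
    (fun x hx => sub_nonneg.mpr (hmap _ (hrefl x hx)).2) hA hB hC
    (by nlinarith [sq_nonneg (1 - a)]) (by linarith)
  constructor
  · rw [div_le_iff₀ (by positivity)]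
    linarith
  · rw [le_div_iff₀ (by positivity)]
    linarith
end
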